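/- Let (X_t)_{t∈ℕ} be a 1-approximating functional with constants (a_k)_{k≥0} of a stationary absolutely regular time series with mixing coefficients (β_k)_{k≥0}. Suppose E X_0 = 0, E|X_0|^{4+δ} < ∞ and Σ_{k=d}^∞ k²(a_k^{δ/(3+δ)} + β_k^{δ/(4+δ)}) < ∞ for some δ > 0 and a fixed integer d ≥ 0. Then n^{−1/2} Σ_{t=1}^n X_t converges in distribution to N(0, σ²) as n → ∞, where σ² = E X_0² + 2 Σ_{k=1}^∞ E(X_0 X_k) and N(0,0) denotes the point mass at the origin. -/

import Mathlib

open MeasureTheory ProbabilityTheory Filter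

noncomputable section

/-- The σ-algebra 𝒜ₖˡ = σ(Z_k, …, Z_l). -/
def sigmaIcc {Ω : Type*} [MeasurableSpace Ω] (Z : ℤ → Ω → ℝ) (k l : ℤ) : MeasurableSpace Ω :=
  ⨆ i ∈ Set.Icc k l, MeasurableSpace.comap (Z i) inferInstance

/-- The σ-algebra 𝒜ₖ^∞ = σ(Z_k, Z_{k+1}, …). -/
def sigmaIci {Ω : Type*} [MeasurableSpace Ω] (Z : ℤ → Ω → ℝ) (k : ℤ) : MeasurableSpace Ω :=
  ⨆ i ∈ Set.Ici k, MeasurableSpace.comap (Z i) inferInstance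

/-- A stationary time series. -/
def Stationary {Ω : Type*} [MeasurableSpace Ω] (μ : Measure Ω) (Z : ℤ → Ω → ℝ) : Prop :=
  ∀ t : ℤ, Measure.map (fun ω => fun s : ℤ => Z (s + t) ω) μ
    = Measure.map (fun ω => fun s : ℤ => Z s ω) μ

/-- The absolute-regularity coefficient of two σ-algebras:
`sup Σ_i Σ_j |P(A_i ∩ B_j) − P(A_i)P(B_j)|` over all finite measurable partitions. -/
def betaCoeff {Ω : Type*} [MeasurableSpace Ω] (μ : Measure Ω)
    (m₁ m₂ : MeasurableSpace Ω) : ℝ :=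
  sSup {r : ℝ | ∃ (I J : ℕ) (A : Fin I → Set Ω) (B : Fin J → Set Ω),
    (∀ i, MeasurableSet[m₁] (A i)) ∧ (∀ j, MeasurableSet[m₂] (B j)) ∧
    Pairwise (Function.onFun Disjoint A) ∧ Pairwise (Function.onFun Disjoint B) ∧
    (⋃ i, A i) = Set.univ ∧ (⋃ j, B j) = Set.univ ∧
    r = ∑ i, ∑ j, |(μ (A i ∩ B j)).toReal - (μ (A i)).toReal * (μ (B j)).toReal|}

/-- The mixing coefficient `β_k = sup_n β(σ(Z_1,…,Z_n), σ(Z_{n+k},…))`. -/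
def betaMix {Ω : Type*} [MeasurableSpace Ω] (μ : Measure Ω) (Z : ℤ → Ω → ℝ) (k : ℕ) : ℝ :=
  sSup {r : ℝ | ∃ n : ℕ, 1 ≤ n ∧ r = betaCoeff μ (sigmaIcc Z 1 n) (sigmaIci Z (n + k))}

/-- Every admissible double sum is at most `2`. -/
lemma beta_term_le_two {Ω : Type*} [m0 : MeasurableSpace Ω] (μ : Measure Ω) [IsProbabilityMeasure μ]
    {I J : ℕ} (A : Fin I → Set Ω) (B : Fin J → Set Ω)
    (hA : ∀ i, MeasurableSet (A i)) (hB : ∀ j, MeasurableSet (B j))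
    (dA : Pairwise (Function.onFun Disjoint A)) (dB : Pairwise (Function.onFun Disjoint B))
    (uA : (⋃ i, A i) = Set.univ) (uB : (⋃ j, B j) = Set.univ) :
    ∑ i, ∑ j, |(μ (A i ∩ B j)).toReal - (μ (A i)).toReal * (μ (B j)).toReal| ≤ 2 := by
  have sA : ∑ i, (μ (A i)).toReal = 1 := by
    have h := measureReal_iUnion_fintype (μ := μ) dA hA
    rw [uA] at h
    simpa [measureReal_def] using h.symm
  have sB : ∑ j, (μ (B j)).toReal = 1 := by
    have h := measureReal_iUnion_fintype (μ := μ) dB hB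
    rw [uB] at h
    simpa [measureReal_def] using h.symm
  have sAB : ∀ i, ∑ j, (μ (A i ∩ B j)).toReal = (μ (A i)).toReal := by
    intro i
    have h := measureReal_iUnion_fintype (μ := μ) (f := fun j => A i ∩ B j)
      (fun a b hab => (dB hab).mono Set.inter_subset_right Set.inter_subset_right)
      (fun j => (hA i).inter (hB j))
    rw [← Set.inter_iUnion, uB, Set.inter_univ] at h
    simpa [measureReal_def] using h.symm
  calc _ ≤ ∑ i, ∑ j, ((μ (A i ∩ B j)).toReal + (μ (A i)).toReal * (μ (B j)).toReal) := by
        gcongr with i _ j _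
        refine (abs_sub _ _).trans ?_
        rw [abs_of_nonneg ENNReal.toReal_nonneg,
          abs_of_nonneg (mul_nonneg ENNReal.toReal_nonneg ENNReal.toReal_nonneg)]
    _ = 2 := by
        simp_rw [Finset.sum_add_distrib, sAB, ← Finset.mul_sum, sB, mul_one, sA]
        norm_num

lemma le_betaCoeff {Ω : Type*} {m₁ m₂ : MeasurableSpace Ω} [m0 : MeasurableSpace Ω] (μ : Measure Ω) [IsProbabilityMeasure μ]
    (h1 : m₁ ≤ m0) (h2 : m₂ ≤ m0)
    {I J : ℕ} (A : Fin I → Set Ω) (B : Fin J → Set Ω)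
    (hA : ∀ i, MeasurableSet[m₁] (A i)) (hB : ∀ j, MeasurableSet[m₂] (B j))
    (dA : Pairwise (Function.onFun Disjoint A)) (dB : Pairwise (Function.onFun Disjoint B))
    (uA : (⋃ i, A i) = Set.univ) (uB : (⋃ j, B j) = Set.univ) :
    ∑ i, ∑ j, |(μ (A i ∩ B j)).toReal - (μ (A i)).toReal * (μ (B j)).toReal|
      ≤ betaCoeff μ m₁ m₂ := by
  refine le_csSup ⟨2, ?_⟩ ⟨I, J, A, B, hA, hB, dA, dB, uA, uB, rfl⟩
  rintro r ⟨I, J, A, B, hA, hB, dA, dB, uA, uB, rfl⟩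
  exact beta_term_le_two μ A B (fun i => h1 _ (hA i)) (fun i => h2 _ (hB i)) dA dB uA uB

lemma betaCoeff_le_two {Ω : Type*} {m₁ m₂ : MeasurableSpace Ω} [m0 : MeasurableSpace Ω] (μ : Measure Ω)
    [IsProbabilityMeasure μ]
    (h1 : m₁ ≤ m0) (h2 : m₂ ≤ m0) :
    betaCoeff μ m₁ m₂ ≤ 2 := by
  refine Real.sSup_le ?_ (by norm_num)
  rintro r ⟨I, J, A, B, hA, hB, dA, dB, uA, uB, rfl⟩
  exact beta_term_le_two μ A B (fun i => h1 _ (hA i)) (fun i => h2 _ (hB i)) dA dB uA uB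

lemma betaCoeff_nonneg {Ω : Type*} (m₁ m₂ : MeasurableSpace Ω) [m0 : MeasurableSpace Ω]
    (μ : Measure Ω) : 0 ≤ betaCoeff μ m₁ m₂ := by
  refine Real.sSup_nonneg ?_
  rintro r ⟨I, J, A, B, hA, hB, dA, dB, uA, uB, rfl⟩
  positivity

lemma betaMix_nonneg {Ω : Type*} [m0 : MeasurableSpace Ω] (μ : Measure Ω)
    (Z : ℤ → Ω → ℝ) (k : ℕ) : 0 ≤ betaMix μ Z k := by
  refine Real.sSup_nonneg ?_
  rintro r ⟨n, _, rfl⟩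
  exact betaCoeff_nonneg _ _ μ

lemma sigmaIcc_le {Ω : Type*} [m0 : MeasurableSpace Ω] (Z : ℤ → Ω → ℝ)
    (hZ : ∀ t, Measurable (Z t)) (k l : ℤ) : sigmaIcc Z k l ≤ m0 :=
  iSup₂_le fun i _ => (hZ i).comap_le

lemma sigmaIci_le {Ω : Type*} [m0 : MeasurableSpace Ω] (Z : ℤ → Ω → ℝ)
    (hZ : ∀ t, Measurable (Z t)) (k : ℤ) : sigmaIci Z k ≤ m0 :=
  iSup₂_le fun i _ => (hZ i).comap_le

lemma betaCoeff_le_betaMix {Ω : Type*} [m0 : MeasurableSpace Ω] (μ : Measure Ω)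
    [IsProbabilityMeasure μ] (Z : ℤ → Ω → ℝ) (hZ : ∀ t, Measurable (Z t)) (k n : ℕ)
    (hn : 1 ≤ n) :
    betaCoeff μ (sigmaIcc Z 1 n) (sigmaIci Z (n + k)) ≤ betaMix μ Z k := by
  refine le_csSup ⟨2, ?_⟩ ⟨n, hn, rfl⟩
  rintro r ⟨n, _, rfl⟩
  exact betaCoeff_le_two μ (sigmaIcc_le Z hZ _ _) (sigmaIci_le Z hZ _)

/-- Covariance of simple functions. -/
lemma cov_simple_le {Ω : Type*} {m₁ m₂ : MeasurableSpace Ω} [m0 : MeasurableSpace Ω] (μ : Measure Ω) [IsProbabilityMeasure μ]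
    (h1 : m₁ ≤ m0) (h2 : m₂ ≤ m0)
    {I J : ℕ} (U : Ω → Fin I) (V : Ω → Fin J) (hU : Measurable[m₁] U) (hV : Measurable[m₂] V)
    (x : Fin I → ℝ) (y : Fin J → ℝ) (hx : ∀ i, |x i| ≤ 1) (hy : ∀ i, |y i| ≤ 1) :
    |∫ ω, x (U ω) * y (V ω) ∂μ - (∫ ω, x (U ω) ∂μ) * ∫ ω, y (V ω) ∂μ| ≤ betaCoeff μ m₁ m₂ := by
  have hU' : ∀ i, MeasurableSet[m₁] (U ⁻¹' {i}) := fun i => hU (measurableSet_singleton i)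
  have hV' : ∀ i, MeasurableSet[m₂] (V ⁻¹' {i}) := fun i => hV (measurableSet_singleton i)
  have key := le_betaCoeff μ h1 h2 (fun i => U ⁻¹' {i}) (fun j => V ⁻¹' {j}) hU' hV'
    (fun a b hab => Disjoint.preimage _ (by simpa using hab))
    (fun a b hab => Disjoint.preimage _ (by simpa using hab))
    (by ext; simp) (by ext; simp)
  have eU : ∫ ω, x (U ω) ∂μ = ∑ i, x i * μ.real (U ⁻¹' {i}) := by
    have : ∀ ω, x (U ω) = ∑ i, (U ⁻¹' {i}).indicator (fun _ => x i) ω := by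
      intro ω
      rw [Finset.sum_eq_single (U ω)]
      · simp
      · intro b _ hb
        exact Set.indicator_of_notMem (fun h => hb h.symm) _
      · simp
    simp_rw [this]
    rw [integral_finsetSum]
    · refine Finset.sum_congr rfl fun i _ => ?_
      rw [integral_indicator_const _ (h1 _ (hU' i))]; simp [mul_comm]
    · intro i _
      exact (integrable_const _).indicator (h1 _ (hU' i))
  have eV : ∫ ω, y (V ω) ∂μ = ∑ j, y j * μ.real (V ⁻¹' {j}) := by
    have : ∀ ω, y (V ω) = ∑ i, (V ⁻¹' {i}).indicator (fun _ => y i) ω := by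
      intro ω
      rw [Finset.sum_eq_single (V ω)]
      · simp
      · intro b _ hb
        exact Set.indicator_of_notMem (fun h => hb h.symm) _
      · simp
    simp_rw [this]
    rw [integral_finsetSum]
    · refine Finset.sum_congr rfl fun i _ => ?_
      rw [integral_indicator_const _ (h2 _ (hV' i))]; simp [mul_comm]
    · intro i _
      exact (integrable_const _).indicator (h2 _ (hV' i))
  have eUV : ∫ ω, x (U ω) * y (V ω) ∂μ
      = ∑ i, ∑ j, x i * y j * μ.real (U ⁻¹' {i} ∩ V ⁻¹' {j}) := by
    have : ∀ ω, x (U ω) * y (V ω)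
        = ∑ i, ∑ j, (U ⁻¹' {i} ∩ V ⁻¹' {j}).indicator (fun _ => x i * y j) ω := by
      intro ω
      rw [Finset.sum_eq_single (U ω), Finset.sum_eq_single (V ω)]
      · simp
      · intro b _ hb
        exact Set.indicator_of_notMem (fun h => hb h.2.symm) _
      · simp
      · intro b _ hb
        exact Finset.sum_eq_zero fun j _ => Set.indicator_of_notMem (fun h => hb h.1.symm) _
      · simp
    simp_rw [this]
    have hm : ∀ i j, MeasurableSet (U ⁻¹' {i} ∩ V ⁻¹' {j}) :=
      fun i j => (h1 _ (hU' i)).inter (h2 _ (hV' j))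
    rw [integral_finsetSum]
    · refine Finset.sum_congr rfl fun i _ => ?_
      rw [integral_finsetSum]
      · refine Finset.sum_congr rfl fun j _ => ?_
        rw [integral_indicator_const _ (hm i j)]; simp [mul_comm]
      · intro j _
        exact (integrable_const _).indicator (hm i j)
    · intro i _
      exact integrable_finsetSum _ fun j _ => (integrable_const _).indicator (hm i j)
  rw [eU, eV, eUV, Finset.sum_mul_sum, ← Finset.sum_sub_distrib]
  refine le_trans ?_ key
  refine (Finset.abs_sum_le_sum_abs _ _).trans (Finset.sum_le_sum fun i _ => ?_)
  rw [← Finset.sum_sub_distrib]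
  refine (Finset.abs_sum_le_sum_abs _ _).trans (Finset.sum_le_sum fun j _ => ?_)
  have : x i * y j * μ.real (U ⁻¹' {i} ∩ V ⁻¹' {j}) -
      x i * μ.real (U ⁻¹' {i}) * (y j * μ.real (V ⁻¹' {j}))
      = x i * y j * (μ.real (U ⁻¹' {i} ∩ V ⁻¹' {j}) -
         μ.real (U ⁻¹' {i}) * μ.real (V ⁻¹' {j})) := by ring
  rw [this, abs_mul, abs_mul]
  have := mul_le_one₀ (hx i) (abs_nonneg _) (hy j)
  exact mul_le_of_le_one_left (abs_nonneg _) this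

/-- Discretisation. -/
lemma exists_discr {Ω : Type*} {m₁ : MeasurableSpace Ω} (F : Ω → ℝ) (hF : Measurable[m₁] F)
    (hF1 : ∀ ω, |F ω| ≤ 1) (N : ℕ) (hN : 0 < N) :
    ∃ (U : Ω → Fin (2 * N + 1)) (x : Fin (2 * N + 1) → ℝ), Measurable[m₁] U ∧
      (∀ i, |x i| ≤ 1) ∧ ∀ ω, |F ω - x (U ω)| ≤ 1 / N := by
  have hN' : (0 : ℝ) < N := by exact_mod_cast hN
  have hN1 : (1 : ℝ) ≤ N := by exact_mod_cast hN
  have hb : ∀ ω, 0 ≤ ((F ω + 1) * N) ∧ ((F ω + 1) * N) ≤ 2 * N := by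
    intro ω
    have := abs_le.1 (hF1 ω)
    constructor
    · exact mul_nonneg (by linarith) hN'.le
    · nlinarith
  have hfl : ∀ ω, ⌊(F ω + 1) * N⌋₊ < 2 * N + 1 := by
    intro ω
    rw [Nat.floor_lt (hb ω).1]
    push_cast
    linarith [(hb ω).2]
  refine ⟨fun ω => ⟨⌊(F ω + 1) * N⌋₊, hfl ω⟩, fun i => (i : ℝ) / N - 1, ?_, ?_, ?_⟩
  · have : Measurable[m₁] (fun ω => ⌊(F ω + 1) * N⌋₊) :=
      Nat.measurable_floor.comp ((hF.add_const 1).mul_const _)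
    refine measurable_to_countable' fun i => ?_
    have h2 := this (measurableSet_singleton (i : ℕ))
    convert h2 using 1
    ext ω
    simp [Fin.ext_iff]
  · intro i
    have hi : (i : ℝ) ≤ 2 * N := by
      have := i.2
      exact_mod_cast Nat.lt_succ_iff.1 this
    have h0 : (i : ℝ) / N ≤ 2 := by rw [div_le_iff₀ hN']; exact hi
    have h1 : 0 ≤ (i : ℝ) / N := by positivity
    rw [abs_le]; constructor <;> linarith
  · intro ω
    have h1 := Nat.floor_le (hb ω).1
    have h2 := Nat.lt_floor_add_one ((F ω + 1) * N)
    have : F ω - ((⌊(F ω + 1) * N⌋₊ : ℝ) / N - 1)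
      = ((F ω + 1) * N - ⌊(F ω + 1) * N⌋₊) / N := by field_simp; ring
    simp only [this]
    rw [abs_div, abs_of_pos hN']
    gcongr
    rw [abs_le]; constructor <;> linarith

lemma cov_le_betaCoeff {Ω : Type*} {m₁ m₂ : MeasurableSpace Ω} [m0 : MeasurableSpace Ω] (μ : Measure Ω)
    [IsProbabilityMeasure μ]
    (h1 : m₁ ≤ m0) (h2 : m₂ ≤ m0)
    (F G : Ω → ℝ) (hF : Measurable[m₁] F) (hG : Measurable[m₂] G)
    (hF1 : ∀ ω, |F ω| ≤ 1) (hG1 : ∀ ω, |G ω| ≤ 1) :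
    |∫ ω, F ω * G ω ∂μ - (∫ ω, F ω ∂μ) * ∫ ω, G ω ∂μ| ≤ betaCoeff μ m₁ m₂ := by
  refine le_of_forall_pos_le_add fun ε hε => ?_
  obtain ⟨N, hN⟩ := exists_nat_gt (4 / ε)
  have hNpos : (0 : ℝ) < N := lt_trans (by positivity) hN
  have hN0 : 0 < N := by exact_mod_cast hNpos
  obtain ⟨U, x, hU, hx, hUx⟩ := exists_discr F hF hF1 N hN0
  obtain ⟨V, y, hV, hy, hVy⟩ := exists_discr G hG hG1 N hN0
  have key := cov_simple_le μ h1 h2 U V hU hV x y hx hy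
  have mF : Measurable F := hF.mono h1 le_rfl
  have mG : Measurable G := hG.mono h2 le_rfl
  have mU : Measurable (fun ω => x (U ω)) := (measurable_of_countable x).comp (hU.mono h1 le_rfl)
  have mV : Measurable (fun ω => y (V ω)) := (measurable_of_countable y).comp (hV.mono h2 le_rfl)
  have bdd : ∀ {H : Ω → ℝ}, Measurable H → (∀ ω, |H ω| ≤ 1) → Integrable H μ := fun hm hb =>
    Integrable.of_bound hm.aestronglyMeasurable 1 (ae_of_all _ hb)
  have iF := bdd mF hF1
  have iG := bdd mG hG1
  have iU := bdd mU (fun ω => hx _)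
  have iV := bdd mV (fun ω => hy _)
  have iFG : Integrable (fun ω => F ω * G ω) μ := bdd (mF.mul mG) (fun ω => by
    rw [abs_mul]; exact mul_le_one₀ (hF1 ω) (abs_nonneg _) (hG1 ω))
  have iUV : Integrable (fun ω => x (U ω) * y (V ω)) μ := bdd (mU.mul mV) (fun ω => by
    rw [abs_mul]; exact mul_le_one₀ (hx _) (abs_nonneg _) (hy _))
  have close : ∀ {H K : Ω → ℝ} (c : ℝ), Integrable H μ → Integrable K μ →
      (∀ ω, |H ω - K ω| ≤ c) → |∫ ω, H ω ∂μ - ∫ ω, K ω ∂μ| ≤ c := by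
    intro H K c iH iK h
    rw [← integral_sub iH iK]
    have := norm_integral_le_of_norm_le_const (μ := μ) (f := fun ω => H ω - K ω) (C := c)
      (ae_of_all _ h)
    simpa using this
  have one : ∀ {H : Ω → ℝ}, Integrable H μ → (∀ ω, |H ω| ≤ 1) → |∫ ω, H ω ∂μ| ≤ 1 := by
    intro H iH h
    have := norm_integral_le_of_norm_le_const (μ := μ) (f := H) (C := 1) (ae_of_all _ h)
    simpa using this
  have prod : ∀ {a b c d : ℝ}, |a| ≤ 1 → |d| ≤ 1 → |a - c| ≤ 1 / N → |b - d| ≤ 1 / N →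
      |a * b - c * d| ≤ 2 / N := by
    intro a b c d ha hd hac hbd
    have : a * b - c * d = a * (b - d) + (a - c) * d := by ring
    rw [this]
    refine (abs_add_le _ _).trans ?_
    rw [abs_mul, abs_mul]
    have e1 : |a| * |b - d| ≤ 1 / N := (mul_le_of_le_one_left (abs_nonneg _) ha).trans hbd
    have e2 : |a - c| * |d| ≤ 1 / N := (mul_le_of_le_one_right (abs_nonneg _) hd).trans hac
    have : (2 : ℝ) / N = 1 / N + 1 / N := by ring
    linarith
  have c1 := close (2 / N) iFG iUV fun ω => prod (hF1 ω) (hy _) (hUx ω) (hVy ω)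
  have c2 := prod (one iF hF1) (one iV fun ω => hy _) (close _ iF iU hUx) (close _ iG iV hVy)
  have c3 : (2 : ℝ) / N + 2 / N ≤ ε := by
    rw [← add_div, div_le_iff₀ hNpos]
    rw [div_lt_iff₀ hε] at hN
    linarith
  have c1' := abs_le.1 c1
  have c2' := abs_le.1 c2
  have k' := abs_le.1 key
  rw [abs_le]
  constructor <;> linarith [c1'.1, c1'.2, c2'.1, c2'.2, k'.1, k'.2]

/-- The shift on path space. -/
def shiftZ (t : ℤ) (z : ℤ → ℝ) : ℤ → ℝ := fun k => z (t + k)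

/-- The law of the process on path space. -/
def pathLaw {Ω : Type*} [MeasurableSpace Ω] (μ : Measure Ω) (Z : ℤ → Ω → ℝ) : Measure (ℤ → ℝ) :=
  Measure.map (fun ω => fun s : ℤ => Z s ω) μ

lemma measurable_shiftZ (t : ℤ) : Measurable (shiftZ t) :=
  measurable_pi_iff.2 fun k => measurable_pi_apply (t + k)

lemma measurable_path {Ω : Type*} [MeasurableSpace Ω] {Z : ℤ → Ω → ℝ}
    (hZ : ∀ t, Measurable (Z t)) : Measurable (fun ω => fun s : ℤ => Z s ω) :=
  measurable_pi_iff.2 hZ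

lemma shiftZ_shiftZ (s t : ℤ) (z : ℤ → ℝ) : shiftZ s (shiftZ t z) = shiftZ (t + s) z := by
  funext k
  simp [shiftZ, add_assoc]

lemma isProb_pathLaw {Ω : Type*} [MeasurableSpace Ω] (μ : Measure Ω) [IsProbabilityMeasure μ]
    (Z : ℤ → Ω → ℝ) (hZ : ∀ t, Measurable (Z t)) : IsProbabilityMeasure (pathLaw μ Z) :=
  Measure.isProbabilityMeasure_map (measurable_path hZ).aemeasurable

lemma mp_shiftZ {Ω : Type*} [MeasurableSpace Ω] (μ : Measure Ω)
    (Z : ℤ → Ω → ℝ) (hZ : ∀ t, Measurable (Z t)) (hs : Stationary μ Z) (t : ℤ) :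
    MeasurePreserving (shiftZ t) (pathLaw μ Z) (pathLaw μ Z) := by
  refine ⟨measurable_shiftZ t, ?_⟩
  rw [pathLaw, Measure.map_map (measurable_shiftZ t) (measurable_path hZ)]
  refine Eq.trans ?_ (hs t)
  congr 1
  funext ω s
  simp [shiftZ, add_comm]

lemma integral_shiftZ {E : Type*} [NormedAddCommGroup E] [NormedSpace ℝ E] [MeasurableSpace E]
    [BorelSpace E] [SecondCountableTopology E] {Ω : Type*} [MeasurableSpace Ω] {μ : Measure Ω}
    {Z : ℤ → Ω → ℝ} (hZ : ∀ t, Measurable (Z t)) (hs : Stationary μ Z) (t : ℤ)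
    {F : (ℤ → ℝ) → E} (hF : Measurable F) :
    ∫ z, F (shiftZ t z) ∂(pathLaw μ Z) = ∫ z, F z ∂(pathLaw μ Z) := by
  have h := mp_shiftZ μ Z hZ hs t
  conv_rhs => rw [← h.map_eq]
  rw [integral_map h.measurable.aemeasurable hF.aestronglyMeasurable]

lemma integrable_shiftZ {Ω : Type*} [MeasurableSpace Ω] {μ : Measure Ω}
    {Z : ℤ → Ω → ℝ} (hZ : ∀ t, Measurable (Z t)) (hs : Stationary μ Z) (t : ℤ)
    {F : (ℤ → ℝ) → ℝ} (hF : Integrable F (pathLaw μ Z)) :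
    Integrable (fun z => F (shiftZ t z)) (pathLaw μ Z) :=
  (mp_shiftZ μ Z hZ hs t).integrable_comp_of_integrable hF

lemma integral_pathLaw {E : Type*} [NormedAddCommGroup E] [NormedSpace ℝ E] [MeasurableSpace E]
    [BorelSpace E] [SecondCountableTopology E] {Ω : Type*} [MeasurableSpace Ω] {μ : Measure Ω}
    {Z : ℤ → Ω → ℝ} (hZ : ∀ t, Measurable (Z t))
    {F : (ℤ → ℝ) → E} (hF : Measurable F) :
    ∫ z, F z ∂(pathLaw μ Z) = ∫ ω, F (fun s => Z s ω) ∂μ := by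
  rw [pathLaw, integral_map (measurable_path hZ).aemeasurable hF.aestronglyMeasurable]

lemma DependsOn.eq_indicator {S : Set ℤ} {β : Type*} {F : (ℤ → ℝ) → β} (h : DependsOn F S)
    (z : ℤ → ℝ) : F z = F (S.indicator z) :=
  h fun _ hi => (Set.indicator_of_mem hi z).symm

lemma DependsOn.shiftZ {S T : Set ℤ} {β : Type*} {F : (ℤ → ℝ) → β} (h : DependsOn F S) (t : ℤ)
    (hST : ∀ i ∈ S, t + i ∈ T) : DependsOn (fun z => F (shiftZ t z)) T :=
  fun _ _ hxy => h fun i hi => hxy (t + i) (hST i hi)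

lemma measurable_comp_dependsOn {Ω : Type*} [MeasurableSpace Ω] {Z : ℤ → Ω → ℝ} {S : Set ℤ}
    (hZ : ∀ i ∈ S, Measurable (Z i))
    {F : (ℤ → ℝ) → ℝ} (hF : Measurable F) (hd : DependsOn F S) :
    Measurable (fun ω => F (fun s => Z s ω)) := by
  have : (fun ω => F (fun s => Z s ω))
      = F ∘ (fun ω => S.indicator (fun s => Z s ω)) := by
    funext ω
    exact hd.eq_indicator _
  rw [this]
  refine hF.comp ?_
  refine measurable_pi_iff.2 fun i => ?_
  by_cases hi : i ∈ S
  · simp only [Set.indicator_of_mem hi]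
    exact hZ i hi
  · simp only [Set.indicator_of_notMem hi]
    exact measurable_const

lemma measurable_sigmaIcc {Ω : Type*} [MeasurableSpace Ω] {Z : ℤ → Ω → ℝ} {k l : ℤ}
    {F : (ℤ → ℝ) → ℝ} (hF : Measurable F) (hd : DependsOn F (Set.Icc k l)) :
    Measurable[sigmaIcc Z k l] (fun ω => F (fun s => Z s ω)) :=
  @measurable_comp_dependsOn Ω (sigmaIcc Z k l) Z _
    (fun i hi => Measurable.of_comap_le (le_iSup₂_of_le i hi le_rfl)) F hF hd

lemma measurable_sigmaIci {Ω : Type*} [MeasurableSpace Ω] {Z : ℤ → Ω → ℝ} {k : ℤ}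
    {F : (ℤ → ℝ) → ℝ} (hF : Measurable F) (hd : DependsOn F (Set.Ici k)) :
    Measurable[sigmaIci Z k] (fun ω => F (fun s => Z s ω)) :=
  @measurable_comp_dependsOn Ω (sigmaIci Z k) Z _
    (fun i hi => Measurable.of_comap_le (le_iSup₂_of_le i hi le_rfl)) F hF hd

lemma cov_path_one {Ω : Type*} [MeasurableSpace Ω] (μ : Measure Ω) [IsProbabilityMeasure μ]
    (Z : ℤ → Ω → ℝ) (hZ : ∀ t, Measurable (Z t)) (hs : Stationary μ Z) (k : ℕ) (p q r : ℤ)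
    (hpq : p ≤ q) (hr : q + k ≤ r) (F G : (ℤ → ℝ) → ℝ) (hF : Measurable F) (hG : Measurable G)
    (dF : DependsOn F (Set.Icc p q)) (dG : DependsOn G (Set.Ici r))
    (hF1 : ∀ z, |F z| ≤ 1) (hG1 : ∀ z, |G z| ≤ 1) :
    |∫ z, F z * G z ∂(pathLaw μ Z) - (∫ z, F z ∂(pathLaw μ Z)) * ∫ z, G z ∂(pathLaw μ Z)|
      ≤ betaMix μ Z k := by
  set t : ℤ := 1 - p with ht
  obtain ⟨n, hn⟩ : ∃ n : ℕ, (n : ℤ) = q - p + 1 := ⟨(q - p + 1).toNat, by omega⟩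
  have hn1 : 1 ≤ n := by omega
  have hFm := hF.comp (measurable_shiftZ t)
  have hGm := hG.comp (measurable_shiftZ t)
  have e1 := integral_shiftZ hZ hs t hF
  have e2 := integral_shiftZ hZ hs t hG
  have e3 := integral_shiftZ hZ hs t (hF.mul hG)
  simp only [Pi.mul_apply] at e3
  rw [← e1, ← e2, ← e3]
  have dF' : DependsOn (fun z => F (shiftZ t z)) (Set.Icc 1 (n : ℤ)) :=
    dF.shiftZ t fun i hi => by
      simp only [Set.mem_Icc] at hi ⊢
      omega
  have dG' : DependsOn (fun z => G (shiftZ t z)) (Set.Ici ((n : ℤ) + k)) :=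
    dG.shiftZ t fun i hi => by
      simp only [Set.mem_Ici] at hi ⊢
      omega
  have e4 := integral_pathLaw (μ := μ) hZ hFm
  have e5 := integral_pathLaw (μ := μ) hZ hGm
  have e6 := integral_pathLaw (μ := μ) hZ (hFm.mul hGm)
  simp only [Pi.mul_apply, Function.comp_apply] at e4 e5 e6
  rw [e4, e5, e6]
  clear_value t
  refine le_trans ?_ (betaCoeff_le_betaMix μ Z hZ k n hn1)
  have m1 : Measurable[sigmaIcc Z 1 n] (fun ω => F (shiftZ t (fun s => Z s ω))) :=
    measurable_sigmaIcc (F := fun z => F (shiftZ t z)) hFm dF'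
  have m2 : Measurable[sigmaIci Z (n + k)] (fun ω => G (shiftZ t (fun s => Z s ω))) :=
    measurable_sigmaIci (F := fun z => G (shiftZ t z)) hGm dG'
  have h1 := sigmaIcc_le Z hZ 1 n
  have h2 := sigmaIci_le Z hZ (n + k)
  exact cov_le_betaCoeff μ h1 h2 (fun ω => F (shiftZ t (fun s => Z s ω)))
    (fun ω => G (shiftZ t (fun s => Z s ω))) m1 m2 (fun _ => hF1 _) (fun _ => hG1 _)

lemma cov_path {Ω : Type*} [MeasurableSpace Ω] (μ : Measure Ω) [IsProbabilityMeasure μ]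
    (Z : ℤ → Ω → ℝ) (hZ : ∀ t, Measurable (Z t)) (hs : Stationary μ Z) (k : ℕ) (p q r : ℤ)
    (hpq : p ≤ q) (hr : q + k ≤ r) (F G : (ℤ → ℝ) → ℝ) (hF : Measurable F) (hG : Measurable G)
    (dF : DependsOn F (Set.Icc p q)) (dG : DependsOn G (Set.Ici r))
    (A B : ℝ) (hA : 0 < A) (hB : 0 < B)
    (hF1 : ∀ z, |F z| ≤ A) (hG1 : ∀ z, |G z| ≤ B) :
    |∫ z, F z * G z ∂(pathLaw μ Z) - (∫ z, F z ∂(pathLaw μ Z)) * ∫ z, G z ∂(pathLaw μ Z)|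
      ≤ A * B * betaMix μ Z k := by
  have h := cov_path_one μ Z hZ hs k p q r hpq hr (fun z => A⁻¹ * F z) (fun z => B⁻¹ * G z)
    (hF.const_mul _) (hG.const_mul _) (fun x y h => by simp only [dF h])
    (fun x y h => by simp only [dG h])
    (fun z => by
      rw [abs_mul, abs_of_pos (inv_pos.2 hA), inv_mul_le_iff₀ hA, mul_one]; exact hF1 z)
    (fun z => by
      rw [abs_mul, abs_of_pos (inv_pos.2 hB), inv_mul_le_iff₀ hB, mul_one]; exact hG1 z)
  have e : ∀ z, A⁻¹ * F z * (B⁻¹ * G z) = (A⁻¹ * B⁻¹) * (F z * G z) := fun z => by ring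
  simp_rw [e, integral_const_mul] at h
  have e' : ∀ u v w : ℝ, A⁻¹ * B⁻¹ * u - A⁻¹ * v * (B⁻¹ * w) = (A * B)⁻¹ * (u - v * w) := by
    intro u v w
    rw [mul_inv]; ring
  rw [e', abs_mul, abs_of_pos (inv_pos.2 (mul_pos hA hB)), inv_mul_le_iff₀ (mul_pos hA hB)] at h
  exact h

lemma cov_path_exp {Ω : Type*} [MeasurableSpace Ω] (μ : Measure Ω) [IsProbabilityMeasure μ]
    (Z : ℤ → Ω → ℝ) (hZ : ∀ t, Measurable (Z t)) (hs : Stationary μ Z) (k : ℕ) (p q r : ℤ)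
    (hpq : p ≤ q) (hr : q + k ≤ r) (F G : (ℤ → ℝ) → ℝ) (hF : Measurable F) (hG : Measurable G)
    (dF : DependsOn F (Set.Icc p q)) (dG : DependsOn G (Set.Ici r))
    (B : ℝ) (hB : 0 < B) (hG1 : ∀ z, |G z| ≤ B) :
    ‖∫ z, Complex.exp (Complex.I * (F z : ℝ)) * (G z : ℝ) ∂(pathLaw μ Z)
      - (∫ z, Complex.exp (Complex.I * (F z : ℝ)) ∂(pathLaw μ Z)) *
        ((∫ z, G z ∂(pathLaw μ Z) : ℝ) : ℂ)‖
      ≤ 2 * B * betaMix μ Z k := by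
  have := isProb_pathLaw μ Z hZ
  set ν := pathLaw μ Z
  have mc : Measurable fun z => Real.cos (F z) := Real.measurable_cos.comp hF
  have ms : Measurable fun z => Real.sin (F z) := Real.measurable_sin.comp hF
  have h1 := cov_path μ Z hZ hs k p q r hpq hr (fun z => Real.cos (F z)) G mc hG
    (fun x y h => by simp only [dF h]) dG 1 B one_pos hB
    (fun z => Real.abs_cos_le_one _) hG1
  have h2 := cov_path μ Z hZ hs k p q r hpq hr (fun z => Real.sin (F z)) G ms hG
    (fun x y h => by simp only [dF h]) dG 1 B one_pos hB
    (fun z => Real.abs_sin_le_one _) hG1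
  have bdd : ∀ {H : (ℤ → ℝ) → ℝ} (C : ℝ), Measurable H → (∀ ω, |H ω| ≤ C) → Integrable H ν :=
    fun C hm hb => Integrable.of_bound hm.aestronglyMeasurable C (ae_of_all _ hb)
  have ic := bdd 1 mc (fun z => Real.abs_cos_le_one _)
  have is := bdd 1 ms (fun z => Real.abs_sin_le_one _)
  have icG : Integrable (fun z => Real.cos (F z) * G z) ν := bdd B (mc.mul hG) (fun z => by
    rw [abs_mul]
    exact (mul_le_of_le_one_left (abs_nonneg _) (Real.abs_cos_le_one _)).trans (hG1 z))
  have isG : Integrable (fun z => Real.sin (F z) * G z) ν := bdd B (ms.mul hG) (fun z => by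
    rw [abs_mul]
    exact (mul_le_of_le_one_left (abs_nonneg _) (Real.abs_sin_le_one _)).trans (hG1 z))
  have e1 : ∫ z, Complex.exp (Complex.I * (F z : ℝ)) ∂ν
      = ((∫ z, Real.cos (F z) ∂ν : ℝ) : ℂ) + ((∫ z, Real.sin (F z) ∂ν : ℝ) : ℂ) * Complex.I := by
    rw [← integral_complex_ofReal, ← integral_complex_ofReal, ← integral_mul_const,
      ← integral_add ic.ofReal (is.ofReal.mul_const _)]
    congr 1
    funext z
    rw [mul_comm, Complex.exp_mul_I]
    simp
  have e2 : ∫ z, Complex.exp (Complex.I * (F z : ℝ)) * (G z : ℝ) ∂ν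
      = ((∫ z, Real.cos (F z) * G z ∂ν : ℝ) : ℂ)
        + ((∫ z, Real.sin (F z) * G z ∂ν : ℝ) : ℂ) * Complex.I := by
    rw [← integral_complex_ofReal, ← integral_complex_ofReal, ← integral_mul_const,
      ← integral_add icG.ofReal (isG.ofReal.mul_const _)]
    congr 1
    funext z
    rw [mul_comm Complex.I, Complex.exp_mul_I]
    simp
    ring
  rw [e1, e2]
  set a := ∫ z, Real.cos (F z) * G z ∂ν
  set b := ∫ z, Real.sin (F z) * G z ∂ν
  set c := ∫ z, Real.cos (F z) ∂ν
  set d := ∫ z, Real.sin (F z) ∂ν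
  set g := ∫ z, G z ∂ν
  have : (a : ℂ) + b * Complex.I - (c + d * Complex.I) * g
    = ((a - c * g : ℝ) : ℂ) + ((b - d * g : ℝ) : ℂ) * Complex.I := by push_cast; ring
  rw [this]
  refine (norm_add_le _ _).trans ?_
  rw [norm_mul, Complex.norm_I, mul_one, Complex.norm_real, Complex.norm_real]
  simp only [Real.norm_eq_abs]
  linarith

/-- `e^{ix}` for real `x`. -/
def ex (x : ℝ) : ℂ := Complex.exp (Complex.I * (x : ℝ))

lemma norm_ex (x : ℝ) : ‖ex x‖ = 1 := by
  rw [ex, mul_comm, Complex.norm_exp_ofReal_mul_I]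

lemma ex_add (x y : ℝ) : ex (x + y) = ex x * ex y := by
  simp [ex, mul_add, Complex.exp_add]

lemma ex_zero : ex 0 = 1 := by simp [ex]

lemma measurable_ex : Measurable ex := by
  unfold ex
  fun_prop

lemma norm_ex_sub_one (x : ℝ) : ‖ex x - 1‖ ≤ |x| := by
  simpa [ex] using Real.norm_exp_I_mul_ofReal_sub_one_le (x := x)

lemma norm_ex_sub (x y : ℝ) : ‖ex x - ex y‖ ≤ |x - y| := by
  have : ex x - ex y = ex y * (ex (x - y) - 1) := by
    rw [mul_sub, ← ex_add]; simp
  rw [this, norm_mul, norm_ex, one_mul]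
  exact norm_ex_sub_one _

lemma norm_ex_two (x : ℝ) : ‖ex x - 1 - Complex.I * x‖ ≤ 3 * |x| ^ 2 := by
  have hn : ‖Complex.I * (x : ℂ)‖ = |x| := by simp
  rcases le_total |x| 1 with h | h
  · have := Complex.norm_exp_sub_one_sub_id_le (x := Complex.I * (x : ℂ)) (by rw [hn]; exact h)
    rw [hn] at this
    refine this.trans ?_
    nlinarith [sq_nonneg |x|]
  · have h1 := norm_ex_sub_one x
    have := norm_sub_le (ex x - 1) (Complex.I * x)
    rw [hn] at this
    nlinarith [abs_nonneg x]

lemma norm_ex_three (x : ℝ) : ‖ex x - 1 - Complex.I * x + (x : ℂ) ^ 2 / 2‖ ≤ 4 * |x| ^ 3 := by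
  have hn : ‖Complex.I * (x : ℂ)‖ = |x| := by simp
  rcases le_total |x| 1 with h | h
  · have := Complex.exp_bound (x := Complex.I * (x : ℂ)) (by rw [hn]; exact h) (n := 3)
      (by norm_num)
    rw [hn] at this
    have e : Complex.exp (Complex.I * x) - ∑ m ∈ Finset.range 3, (Complex.I * (x : ℂ)) ^ m /
        (m.factorial : ℂ) = ex x - 1 - Complex.I * x + (x : ℂ) ^ 2 / 2 := by
      simp [Finset.sum_range_succ, ex, mul_pow, Nat.factorial]
      ring
    rw [e] at this
    refine this.trans ?_
    have : (0 : ℝ) ≤ |x| ^ 3 := by positivity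
    norm_num [Nat.factorial]
    linarith
  · have h1 := norm_ex_sub_one x
    have h2 := norm_sub_le (ex x - 1) (Complex.I * x)
    rw [hn] at h2
    have h3 := norm_add_le (ex x - 1 - Complex.I * x) ((x : ℂ) ^ 2 / 2)
    have h4 : ‖(x : ℂ) ^ 2 / 2‖ = |x| ^ 2 / 2 := by simp
    rw [h4] at h3
    have h5 : |x| ≤ |x| ^ 2 := by nlinarith
    have h6 : |x| ^ 2 ≤ |x| ^ 3 := by nlinarith [sq_nonneg |x|]
    linarith

lemma pointwise_step (w x a b : ℝ) :
    ‖ex (w + x) - ex w - Complex.I * (ex (w - a) * x) + ex (w - a - b) * ((x * (a + x / 2) : ℝ) : ℂ)‖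
      ≤ 4 * (|x| * (|x| + |a| + |b|) ^ 2) := by
  set e' := ex (w - a) with he'
  set e'' := ex (w - a - b) with he''
  have hw : ex w = e' * ex a := by rw [he', ← ex_add]; simp
  have hwx : ex (w + x) = e' * ex a * ex x := by rw [ex_add, hw]
  have decomp : ex (w + x) - ex w - Complex.I * (e' * x) + e'' * ((x * (a + x / 2) : ℝ) : ℂ)
      = e' * ex a * (ex x - 1 - Complex.I * x + (x : ℂ) ^ 2 / 2)
        + e' * (ex a - 1 - Complex.I * a) * (Complex.I * x)
        - e' * (ex a - 1) * ((x : ℂ) ^ 2 / 2)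
        - (e' - e'') * ((x * (a + x / 2) : ℝ) : ℂ) := by
    rw [hwx, hw]
    push_cast
    linear_combination (e' * a * x) * Complex.I_sq
  have n1 : ‖e'‖ = 1 := norm_ex _
  have n2 : ‖ex a‖ = 1 := norm_ex _
  have hb : ‖e' - e''‖ ≤ |b| := by
    have := norm_ex_sub (w - a) (w - a - b)
    simpa using this
  have t1 : ‖e' * ex a * (ex x - 1 - Complex.I * x + (x : ℂ) ^ 2 / 2)‖ ≤ 4 * |x| ^ 3 := by
    rw [norm_mul, norm_mul, n1, n2, one_mul, one_mul]; exact norm_ex_three x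
  have t2 : ‖e' * (ex a - 1 - Complex.I * a) * (Complex.I * x)‖ ≤ 3 * |a| ^ 2 * |x| := by
    rw [norm_mul, norm_mul, n1, one_mul]
    have : ‖Complex.I * (x : ℂ)‖ = |x| := by simp
    rw [this]
    gcongr
    exact norm_ex_two a
  have t3 : ‖e' * (ex a - 1) * ((x : ℂ) ^ 2 / 2)‖ ≤ |a| * (|x| ^ 2 / 2) := by
    rw [norm_mul, norm_mul, n1, one_mul]
    have : ‖(x : ℂ) ^ 2 / 2‖ = |x| ^ 2 / 2 := by simp
    rw [this]
    gcongr
    exact norm_ex_sub_one a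
  have t4 : ‖(e' - e'') * ((x * (a + x / 2) : ℝ) : ℂ)‖ ≤ |b| * (|x| * (|a| + |x|)) := by
    rw [norm_mul, Complex.norm_real, Real.norm_eq_abs, abs_mul]
    gcongr
    refine (abs_add_le _ _).trans ?_
    rw [abs_div]
    gcongr
    norm_num
  rw [decomp]
  refine (norm_sub_le _ _).trans ?_
  refine (add_le_add (norm_sub_le _ _) t4).trans ?_
  refine (add_le_add_left (add_le_add (norm_add_le _ _) t3) _).trans ?_
  have hx := abs_nonneg x
  have ha := abs_nonneg a
  have hb' := abs_nonneg b
  have f1 : 4 * |x| ^ 3 + 3 * |a| ^ 2 * |x| + |a| * (|x| ^ 2 / 2) + |b| * (|x| * (|a| + |x|))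
      ≤ 4 * (|x| * (|x| + |a| + |b|) ^ 2) := by
    have p1 : 0 ≤ |x| * |a| ^ 2 := by positivity
    have p2 : 0 ≤ |x| ^ 2 * |a| := by positivity
    have p3 : 0 ≤ |x| ^ 2 * |b| := by positivity
    have p4 : 0 ≤ |x| * |a| * |b| := by positivity
    have p5 : 0 ≤ |x| * |b| ^ 2 := by positivity
    nlinarith
  linarith

lemma integrable_ex {Ω : Type*} [MeasurableSpace Ω] (ν : Measure Ω) [IsProbabilityMeasure ν]
    {w : Ω → ℝ} (hw : Measurable w) : Integrable (fun z => ex (w z)) ν :=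
  Integrable.of_bound (measurable_ex.comp hw).aestronglyMeasurable 1
    (ae_of_all _ fun _ => (norm_ex _).le)

lemma integrable_ex_mul {Ω : Type*} [MeasurableSpace Ω] (ν : Measure Ω)
    {w y : Ω → ℝ} (hw : Measurable w) (hy : Integrable y ν) :
    Integrable (fun z => ex (w z) * (y z : ℂ)) ν :=
  Integrable.bdd_mul (c := 1) hy.ofReal (measurable_ex.comp hw).aestronglyMeasurable
    (ae_of_all _ fun _ => (norm_ex _).le)

lemma step_lemma {Ω : Type*} [MeasurableSpace Ω] (ν : Measure Ω) [IsProbabilityMeasure ν]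
    (c : ℝ) (w y N N' A : Ω → ℝ) (mw : Measurable w) (my : Measurable y) (mN : Measurable N)
    (mN' : Measurable N') (hA : ∀ z, |y z| + |N z| + |N' z| ≤ A z)
    (iy : Integrable y ν) (iA : Integrable A ν)
    (iq : Integrable (fun z => y z * (N z + y z / 2)) ν)
    (iA2 : Integrable (fun z => |y z| * A z ^ 2) ν)
    (D1 D2 D3 e1 e2 : ℝ) (h1 : ∫ z, A z ∂ν ≤ D1) (h3 : ∫ z, |y z| * A z ^ 2 ∂ν ≤ D3)
    (h2 : |∫ z, y z * (N z + y z / 2) ∂ν| ≤ D2)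
    (H1 : ‖∫ z, ex (c * (w z - N z)) * (y z : ℂ) ∂ν‖ ≤ e1)
    (H2 : ‖∫ z, ex (c * (w z - N z - N' z)) * ((y z * (N z + y z / 2) : ℝ) : ℂ) ∂ν
      - (∫ z, ex (c * (w z - N z - N' z)) ∂ν) * ((∫ z, y z * (N z + y z / 2) ∂ν : ℝ) : ℂ)‖ ≤ e2) :
    ‖∫ z, ex (c * (w z + y z)) ∂ν
        - ((1 - c ^ 2 * ∫ z, y z * (N z + y z / 2) ∂ν : ℝ) : ℂ) * ∫ z, ex (c * w z) ∂ν‖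
      ≤ 4 * |c| ^ 3 * D3 + |c| * e1 + c ^ 2 * e2 + |c| ^ 3 * D1 * D2 := by
  set v := ∫ z, y z * (N z + y z / 2) ∂ν with hv
  have m1 : Measurable fun z => c * (w z + y z) := by fun_prop
  have m2 : Measurable fun z => c * w z := by fun_prop
  have m3 : Measurable fun z => c * (w z - N z) := by fun_prop
  have m4 : Measurable fun z => c * (w z - N z - N' z) := by fun_prop
  have i1 := integrable_ex ν m1
  have i2 := integrable_ex ν m2
  have i3 := integrable_ex_mul ν m3 iy
  have i4 := integrable_ex_mul ν m4 iq
  have i5 := integrable_ex ν m4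
  set u1 := ∫ z, ex (c * (w z + y z)) ∂ν
  set u2 := ∫ z, ex (c * w z) ∂ν
  set u3 := ∫ z, ex (c * (w z - N z)) * (y z : ℂ) ∂ν
  set u4 := ∫ z, ex (c * (w z - N z - N' z)) * ((y z * (N z + y z / 2) : ℝ) : ℂ) ∂ν
  set u5 := ∫ z, ex (c * (w z - N z - N' z)) ∂ν
  have key : ‖u1 - u2 - (Complex.I * c) * u3 + (c : ℂ) ^ 2 * u4‖ ≤ 4 * |c| ^ 3 * D3 := by
    have e : u1 - u2 - (Complex.I * c) * u3 + (c : ℂ) ^ 2 * u4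
        = ∫ z, (ex (c * (w z + y z)) - ex (c * w z)
          - (Complex.I * c) * (ex (c * (w z - N z)) * (y z : ℂ))
          + (c : ℂ) ^ 2 * (ex (c * (w z - N z - N' z)) * ((y z * (N z + y z / 2) : ℝ) : ℂ))) ∂ν := by
      have i12 : Integrable (fun z => ex (c * (w z + y z)) - ex (c * w z)) ν := i1.sub i2
      have i123 : Integrable (fun z => ex (c * (w z + y z)) - ex (c * w z)
          - (Complex.I * c) * (ex (c * (w z - N z)) * (y z : ℂ))) ν := i12.sub (i3.const_mul _)
      rw [integral_add i123 (i4.const_mul _),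
        integral_sub i12 (i3.const_mul _), integral_sub i1 i2, integral_const_mul,
        integral_const_mul]
    rw [e]
    have hb : ∀ z, ‖ex (c * (w z + y z)) - ex (c * w z)
          - (Complex.I * c) * (ex (c * (w z - N z)) * (y z : ℂ))
          + (c : ℂ) ^ 2 * (ex (c * (w z - N z - N' z)) * ((y z * (N z + y z / 2) : ℝ) : ℂ))‖
          ≤ 4 * |c| ^ 3 * (|y z| * A z ^ 2) := by
      intro z
      have := pointwise_step (c * w z) (c * y z) (c * N z) (c * N' z)
      have e1 : c * (w z + y z) = c * w z + c * y z := by ring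
      have e2 : c * (w z - N z) = c * w z - c * N z := by ring
      have e3 : c * (w z - N z - N' z) = c * w z - c * N z - c * N' z := by ring
      rw [e1, e3, e2]
      have e4 : Complex.I * (c : ℂ) * (ex (c * w z - c * N z) * (y z : ℂ))
        = Complex.I * (ex (c * w z - c * N z) * ((c * y z : ℝ) : ℂ)) := by push_cast; ring
      have e5 : (c : ℂ) ^ 2 * (ex (c * w z - c * N z - c * N' z) *
          ((y z * (N z + y z / 2) : ℝ) : ℂ)) = ex (c * w z - c * N z - c * N' z) *
          ((c * y z * (c * N z + c * y z / 2) : ℝ) : ℂ) := by push_cast; ring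
      rw [e4, e5]
      refine this.trans ?_
      have e6 : |c * y z| + |c * N z| + |c * N' z| = |c| * (|y z| + |N z| + |N' z|) := by
        rw [abs_mul, abs_mul, abs_mul]; ring
      rw [e6, abs_mul, mul_pow]
      have e7 : 4 * |c| ^ 3 * (|y z| * A z ^ 2) = 4 * (|c| * |y z| * (|c| ^ 2 * A z ^ 2)) := by
        ring
      rw [e7]
      gcongr
      exact hA z
    refine (norm_integral_le_of_norm_le (iA2.const_mul _) (ae_of_all _ hb)).trans ?_
    rw [integral_const_mul]
    gcongr
  have hu5 : ‖u5 - u2‖ ≤ |c| * D1 := by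
    have : u5 - u2 = ∫ z, (ex (c * (w z - N z - N' z)) - ex (c * w z)) ∂ν := by
      rw [integral_sub i5 i2]
    rw [this]
    have hb : ∀ z, ‖ex (c * (w z - N z - N' z)) - ex (c * w z)‖ ≤ |c| * A z := by
      intro z
      refine (norm_ex_sub _ _).trans ?_
      have : c * (w z - N z - N' z) - c * w z = c * (-N z - N' z) := by ring
      rw [this, abs_mul]
      gcongr
      have h4 := hA z
      have h5 := abs_sub (-N z) (N' z)
      rw [abs_neg] at h5
      linarith [abs_nonneg (y z)]
    refine (norm_integral_le_of_norm_le (iA.const_mul _) (ae_of_all _ hb)).trans ?_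
    rw [integral_const_mul]
    gcongr
  have fin : u1 - ((1 - c ^ 2 * v : ℝ) : ℂ) * u2
      = (u1 - u2 - (Complex.I * c) * u3 + (c : ℂ) ^ 2 * u4) + (Complex.I * c) * u3
        - (c : ℂ) ^ 2 * (u4 - u5 * (v : ℂ)) - (c : ℂ) ^ 2 * (v : ℂ) * (u5 - u2) := by
    push_cast; ring
  rw [fin]
  have nc2 : ‖(c : ℂ) ^ 2‖ = c ^ 2 := by simp
  have b1 : ‖(Complex.I * c) * u3‖ ≤ |c| * e1 := by
    rw [norm_mul, norm_mul, Complex.norm_I, one_mul, Complex.norm_real, Real.norm_eq_abs]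
    gcongr
  have b2 : ‖(c : ℂ) ^ 2 * (u4 - u5 * (v : ℂ))‖ ≤ c ^ 2 * e2 := by
    rw [norm_mul, nc2]; gcongr
  have b3 : ‖(c : ℂ) ^ 2 * (v : ℂ) * (u5 - u2)‖ ≤ |c| ^ 3 * D1 * D2 := by
    rw [norm_mul, norm_mul, nc2, Complex.norm_real, Real.norm_eq_abs]
    have : |c| ^ 3 * D1 * D2 = c ^ 2 * D2 * (|c| * D1) := by rw [← sq_abs c]; ring
    rw [this]
    have hD2 : 0 ≤ D2 := (abs_nonneg _).trans h2
    gcongr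
  refine (norm_sub_le _ _).trans (add_le_add ?_ b3)
  refine (norm_sub_le _ _).trans (add_le_add ?_ b2)
  exact (norm_add_le _ _).trans (add_le_add key b1)

/-- Discrete Gronwall. -/
lemma chain_lemma (u : ℕ → ℂ) (ρ : ℂ) (G R R0 : ℝ) (J : ℕ) (hG : 1 ≤ G) (hρ : ‖ρ‖ ≤ G)
    (hR : 0 ≤ R) (hR0 : 0 ≤ R0) (h0 : u 0 = 1)
    (hlo : ∀ j, j < J → ‖u (j + 1) - ρ * u j‖ ≤ R0)
    (hhi : ∀ j, J ≤ j → ‖u (j + 1) - ρ * u j‖ ≤ R) (n : ℕ) :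
    ‖u n - ρ ^ n‖ ≤ G ^ n * (n * R + J * R0) := by
  have main : ∀ n : ℕ, ‖u n - ρ ^ n‖ ≤ G ^ n * (n * R + (min n J : ℕ) * R0) := by
    intro n
    induction n with
    | zero => simp [h0]
    | succ n ih =>
      have e : u (n + 1) - ρ ^ (n + 1) = (u (n + 1) - ρ * u n) + ρ * (u n - ρ ^ n) := by ring
      rw [e]
      have hGn : (1 : ℝ) ≤ G ^ (n + 1) := one_le_pow₀ hG
      have h2 : ‖ρ * (u n - ρ ^ n)‖ ≤ G * (G ^ n * (n * R + (min n J : ℕ) * R0)) := by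
        rw [norm_mul]; gcongr
      refine (norm_add_le _ _).trans ?_
      rcases lt_or_ge n J with h | h
      · have h1 := hlo n h
        have m1 : min n J = n := by omega
        have m2 : min (n + 1) J = n + 1 := by omega
        rw [m1] at h2
        rw [m2]
        push_cast
        have : R + R0 ≤ G ^ (n + 1) * (R + R0) := le_mul_of_one_le_left (by positivity) hGn
        calc _ ≤ R0 + G * (G ^ n * (n * R + n * R0)) := add_le_add h1 h2
          _ ≤ G ^ (n + 1) * (R + R0) + G * (G ^ n * (n * R + n * R0)) := by linarith
          _ = _ := by ring
      · have h1 := hhi n h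
        have m1 : min n J = J := by omega
        have m2 : min (n + 1) J = J := by omega
        rw [m1] at h2
        rw [m2]
        push_cast
        have : R ≤ G ^ (n + 1) * R := le_mul_of_one_le_left hR hGn
        calc _ ≤ R + G * (G ^ n * (n * R + J * R0)) := add_le_add h1 h2
          _ ≤ G ^ (n + 1) * R + G * (G ^ n * (n * R + J * R0)) := by linarith
          _ = _ := by ring
  refine (main n).trans ?_
  have : 0 ≤ G ^ n := by positivity
  gcongr
  exact min_le_right _ _

lemma exists_window {Ω : Type*} [MeasurableSpace Ω] (μ : Measure Ω) [IsProbabilityMeasure μ]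
    (Z : ℤ → Ω → ℝ) (hZ : ∀ t, Measurable (Z t)) (f : (ℤ → ℝ) → ℝ) (hf : Measurable f)
    (X0 : Ω → ℝ) (hX : ∀ ω, X0 ω = f (fun s => Z s ω)) (k l : ℤ) (a : ℝ)
    (ha : ∫ ω, |X0 ω - (μ[X0 | sigmaIcc Z k l]) ω| ∂μ ≤ a) :
    ∃ h : (ℤ → ℝ) → ℝ, Measurable h ∧ DependsOn h (Set.Icc k l) ∧
      Integrable h (pathLaw μ Z) ∧ ∫ z, |f z - h z| ∂(pathLaw μ Z) ≤ a := by
  set g : Ω → (ℤ → ℝ) := fun ω => (Set.Icc k l).indicator (fun s => Z s ω) with hg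
  have hle : sigmaIcc Z k l ≤ MeasurableSpace.comap g inferInstance := by
    refine iSup₂_le fun i hi => ?_
    have : Z i = (fun z : ℤ → ℝ => z i) ∘ g := by
      funext ω
      simp only [hg, Function.comp_apply, Set.indicator_of_mem hi]
    rw [this, ← MeasurableSpace.comap_comp]
    exact MeasurableSpace.comap_mono (measurable_pi_apply i).comap_le
  have hm : Measurable[MeasurableSpace.comap g inferInstance] (μ[X0 | sigmaIcc Z k l]) :=
    (stronglyMeasurable_condExp.mono hle).measurable
  obtain ⟨h', mh', hh'⟩ := hm.exists_eq_measurable_comp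
  have mind : Measurable (fun z : ℤ → ℝ => (Set.Icc k l).indicator z) := by
    refine measurable_pi_iff.2 fun i => ?_
    by_cases hi : i ∈ Set.Icc k l
    · simp only [Set.indicator_of_mem hi]; exact measurable_pi_apply i
    · simp only [Set.indicator_of_notMem hi]; exact measurable_const
  have mh : Measurable (fun z : ℤ → ℝ => h' ((Set.Icc k l).indicator z)) := mh'.comp mind
  have e : ∀ ω, h' ((Set.Icc k l).indicator (fun s => Z s ω)) = (μ[X0 | sigmaIcc Z k l]) ω :=
    fun ω => by rw [hh']; rfl
  refine ⟨fun z => h' ((Set.Icc k l).indicator z), mh, ?_, ?_, ?_⟩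
  · intro x y hxy
    have : (Set.Icc k l).indicator x = (Set.Icc k l).indicator y := by
      funext i
      by_cases hi : i ∈ Set.Icc k l
      · simp only [Set.indicator_of_mem hi]; exact hxy i hi
      · simp only [Set.indicator_of_notMem hi]
    simp only [this]
  · rw [pathLaw, integrable_map_measure mh.aestronglyMeasurable (measurable_path hZ).aemeasurable]
    have : (fun z : ℤ → ℝ => h' ((Set.Icc k l).indicator z)) ∘ (fun ω s => Z s ω)
        = μ[X0 | sigmaIcc Z k l] := funext e
    rw [this]
    exact integrable_condExp
  · rw [integral_pathLaw hZ (F := fun z => |f z - h' ((Set.Icc k l).indicator z)|)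
      (hf.sub mh).abs]
    simp_rw [e, ← hX]
    exact ha

/-- Truncation at level `M`. -/
def clip (M x : ℝ) : ℝ := max (-M) (min M x)

lemma measurable_clip (M : ℝ) : Measurable (clip M) := by
  unfold clip; fun_prop

lemma abs_clip_le {M : ℝ} (hM : 0 ≤ M) (x : ℝ) : |clip M x| ≤ M := by
  unfold clip
  rw [abs_le]
  exact ⟨le_max_left _ _, max_le (by linarith) (min_le_left _ _)⟩

lemma abs_clip_sub_clip (M x y : ℝ) : |clip M x - clip M y| ≤ |x - y| := by
  unfold clip
  refine (abs_max_sub_max_le_max _ _ _ _).trans ?_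
  refine max_le (by simp) ?_
  refine (abs_min_sub_min_le_max _ _ _ _).trans ?_
  exact max_le (by simp) le_rfl

lemma clip_of_le {M x : ℝ} (h : |x| ≤ M) : clip M x = x := by
  have := abs_le.1 h
  unfold clip
  rw [min_eq_right this.2, max_eq_right this.1]

lemma abs_clip_le_abs {M : ℝ} (hM : 0 ≤ M) (x : ℝ) : |clip M x| ≤ |x| := by
  have := abs_clip_sub_clip M x 0
  rwa [clip_of_le (x := 0) (by simpa using hM), sub_zero, sub_zero] at this

lemma abs_sub_clip_le_abs {M : ℝ} (hM : 0 ≤ M) (x : ℝ) : |x - clip M x| ≤ |x| := by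
  rcases le_total |x| M with h | h
  · rw [clip_of_le h]; simp
  · unfold clip
    rcases le_total 0 x with h0 | h0
    · rw [abs_of_nonneg h0] at h ⊢
      rw [min_eq_left h, max_eq_right (by linarith), abs_le]; constructor <;> linarith
    · rw [abs_of_nonpos h0] at h ⊢
      rw [min_eq_right (by linarith), max_eq_left (by linarith), abs_le]; constructor <;> linarith

/-- Markov-type bound for the truncation error. -/
lemma abs_sub_clip_le {M : ℝ} (hM : 0 < M) (x p q : ℝ) (hp : 0 ≤ p) (hq : q = 1 + p) :
    |x - clip M x| ≤ M ^ (-p) * |x| ^ q := by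
  rcases le_or_gt |x| M with h | h
  · rw [clip_of_le h]; simp; positivity
  · refine (abs_sub_clip_le_abs hM.le x).trans ?_
    have hx : 0 < |x| := hM.trans h
    rw [hq, Real.rpow_add hx, Real.rpow_one, Real.rpow_neg hM.le]
    have : 1 ≤ (M ^ p)⁻¹ * |x| ^ p := by
      rw [← div_eq_inv_mul, one_le_div (by positivity)]
      exact Real.rpow_le_rpow hM.le h.le hp
    calc |x| = |x| * 1 := by ring
      _ ≤ |x| * ((M ^ p)⁻¹ * |x| ^ p) := by gcongr
      _ = _ := by ring

lemma rpow_mul_le (x y p q : ℝ) (hx : 0 ≤ x) (hy : 0 ≤ y) (hp : 0 ≤ p) (hq : q = p + 1) :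
    x ^ p * y ≤ x ^ q + y ^ q := by
  have h0 : ∀ t : ℝ, 0 ≤ t → t ^ q = t ^ p * t := by
    intro t ht
    rw [hq, Real.rpow_add_one' ht (by linarith)]
  rw [h0 x hx, h0 y hy]
  rcases le_total x y with h | h
  · have := Real.rpow_le_rpow hx h hp
    have : x ^ p * y ≤ y ^ p * y := by gcongr
    have : 0 ≤ x ^ p * x := by positivity
    linarith
  · have : x ^ p * y ≤ x ^ p * x := by gcongr
    have : 0 ≤ y ^ p * y := by positivity
    linarith

lemma pow_le_one_add_rpow {x δ : ℝ} (hx : 0 ≤ x) (hδ : 0 < δ) (k : ℕ) (hk : k ≤ 4) :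
    x ^ k ≤ 1 + x ^ (4 + δ) := by
  rcases le_total x 1 with h | h
  · have : x ^ k ≤ 1 := pow_le_one₀ hx h
    have : 0 ≤ x ^ (4 + δ) := by positivity
    linarith
  · have : x ^ k ≤ x ^ (4 + δ) := by
      rw [← Real.rpow_natCast]
      refine Real.rpow_le_rpow_of_exponent_le h ?_
      have : (k : ℝ) ≤ 4 := by exact_mod_cast hk
      linarith
    linarith

lemma approximant (ν : Measure (ℤ → ℝ)) [IsProbabilityMeasure ν]
    (mp : ∀ t, MeasurePreserving (shiftZ t) ν ν) (f : (ℤ → ℝ) → ℝ) (mf : Measurable f)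
    (jf : Integrable f ν) (hmean : ∫ z, f z ∂ν = 0) (δ : ℝ) (hδ : 0 < δ)
    (hmom : Integrable (fun z => |f z| ^ ((4 : ℝ) + δ)) ν)
    (K0 : ℝ) (hK : ∫ z, |f z| ^ ((4 : ℝ) + δ) ∂ν ≤ K0) (S : Set ℤ)
    (h0 : (ℤ → ℝ) → ℝ) (mh0 : Measurable h0) (d0 : DependsOn h0 S) (i0 : Integrable h0 ν)
    (a : ℝ) (ha : ∫ z, |f z - h0 z| ∂ν ≤ a) (M : ℝ) (hM : 0 < M) :
    ∃ h : (ℤ → ℝ) → ℝ, Measurable h ∧ DependsOn h S ∧ (∀ z, |h z| ≤ 2 * M) ∧ ∫ z, h z ∂ν = 0 ∧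
      ∫ z, |f z - h z| ∂ν ≤ 2 * (a + M ^ (-(3 + δ)) * K0) ∧
      ∫ z, |h z| ^ 3 ∂ν ≤ 72 * M ^ 2 * (a + M ^ (-(3 + δ)) * K0) + 4 * (1 + K0) ∧
      ∀ i j, |∫ z, f (shiftZ i z) * f (shiftZ j z) ∂ν - ∫ z, h (shiftZ i z) * h (shiftZ j z) ∂ν|
        ≤ 6 * M * (a + M ^ (-(3 + δ)) * K0) + 4 * (M ^ (-(2 + δ)) * K0) := by
  have shI : ∀ {F : (ℤ → ℝ) → ℝ} (t : ℤ), Measurable F →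
      ∫ z, F (shiftZ t z) ∂ν = ∫ z, F z ∂ν := by
    intro F t hF
    conv_rhs => rw [← (mp t).map_eq]
    rw [integral_map (mp t).measurable.aemeasurable hF.aestronglyMeasurable]
  have shJ : ∀ {F : (ℤ → ℝ) → ℝ} (t : ℤ), Integrable F ν →
      Integrable (fun z => F (shiftZ t z)) ν := fun t hF =>
    (mp t).integrable_comp_of_integrable hF
  have hK0 : 0 ≤ K0 := (integral_nonneg fun z => by positivity).trans hK
  set b0 := a + M ^ (-(3 + δ)) * K0 with hb0
  set g : (ℤ → ℝ) → ℝ := fun z => clip M (h0 z) with hg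
  set fb : (ℤ → ℝ) → ℝ := fun z => clip M (f z) with hfb
  have mg : Measurable g := (measurable_clip M).comp mh0
  have mfb : Measurable fb := (measurable_clip M).comp mf
  have bg : ∀ z, |g z| ≤ M := fun z => abs_clip_le hM.le _
  have bfb : ∀ z, |fb z| ≤ M := fun z => abs_clip_le hM.le _
  have jg : Integrable g ν := Integrable.of_bound mg.aestronglyMeasurable M (ae_of_all _ bg)
  have jfb : Integrable fb ν := Integrable.of_bound mfb.aestronglyMeasurable M (ae_of_all _ bfb)
  -- distances
  have d1 : ∫ z, |fb z - g z| ∂ν ≤ a := by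
    refine le_trans (integral_mono (jfb.sub jg).abs (jf.sub i0).abs fun z => ?_) ha
    exact abs_clip_sub_clip M (f z) (h0 z)
  have d2 : ∫ z, |f z - fb z| ∂ν ≤ M ^ (-(3 + δ)) * K0 := by
    refine le_trans (integral_mono (jf.sub jfb).abs (hmom.const_mul (M ^ (-(3 + δ)))) fun z => ?_) ?_
    · exact abs_sub_clip_le hM (f z) (3 + δ) (4 + δ) (by linarith) (by ring)
    · rw [integral_const_mul]; gcongr
  have d3 : ∫ z, |f z - g z| ∂ν ≤ b0 := by
    have : ∫ z, |f z - g z| ∂ν ≤ ∫ z, (|fb z - g z| + |f z - fb z|) ∂ν := by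
      refine integral_mono (jf.sub jg).abs ((jfb.sub jg).abs.add (jf.sub jfb).abs) fun z => ?_
      have := abs_sub_le (f z) (fb z) (g z)
      simp only [Pi.sub_apply]
      linarith
    have e : ∫ z, (|fb z - g z| + |f z - fb z|) ∂ν
        = ∫ z, |fb z - g z| ∂ν + ∫ z, |f z - fb z| ∂ν :=
      integral_add (jfb.sub jg).abs (jf.sub jfb).abs
    rw [e] at this
    linarith
  have hb0n : 0 ≤ b0 := (integral_nonneg fun z => abs_nonneg _).trans d3
  set c := ∫ z, g z ∂ν with hc
  have hcb : |c| ≤ b0 := by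
    have : c = - ∫ z, (f z - g z) ∂ν := by rw [integral_sub jf jg, hmean]; simp [hc]
    rw [this, abs_neg]
    exact (abs_integral_le_integral_abs).trans d3
  have hcM : |c| ≤ M := by
    have := norm_integral_le_of_norm_le_const (μ := ν) (f := g) (C := M) (ae_of_all _ bg)
    simpa using this
  set h : (ℤ → ℝ) → ℝ := fun z => g z - c with hh
  have mh : Measurable h := mg.sub_const c
  have bh : ∀ z, |h z| ≤ 2 * M := fun z => (abs_sub _ _).trans (by linarith [bg z])
  have jh : Integrable h ν := jg.sub (integrable_const c)
  have d4 : ∫ z, |f z - h z| ∂ν ≤ 2 * b0 := by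
    have : ∫ z, |f z - h z| ∂ν ≤ ∫ z, (|f z - g z| + |c|) ∂ν := by
      refine integral_mono (jf.sub jh).abs ((jf.sub jg).abs.add (integrable_const _)) fun z => ?_
      have e : f z - h z = (f z - g z) + c := by simp only [hh]; ring
      simp only [Pi.sub_apply]
      rw [e]
      exact abs_add_le _ _
    have e : ∫ z, (|f z - g z| + |c|) ∂ν = ∫ z, |f z - g z| ∂ν + |c| := by
      have jj : Integrable (fun z => |f z - g z|) ν := (jf.sub jg).abs
      rw [integral_add jj (integrable_const _)]; simp
    linarith
  refine ⟨h, mh, fun x y hxy => by simp only [hh, hg, d0 hxy], bh, ?_, d4, ?_, ?_⟩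
  · simp only [hh]
    rw [integral_sub jg (integrable_const _)]; simp [hc]
  · -- third moment
    have d5 : ∫ z, |h z - fb z| ∂ν ≤ 2 * b0 := by
      have : ∫ z, |h z - fb z| ∂ν ≤ ∫ z, (|fb z - g z| + |c|) ∂ν := by
        refine integral_mono (jh.sub jfb).abs ((jfb.sub jg).abs.add (integrable_const _))
          fun z => ?_
        have e : h z - fb z = -((fb z - g z) + c) := by simp only [hh]; ring
        simp only [Pi.sub_apply]
        rw [e, abs_neg]
        exact abs_add_le _ _
      have e : ∫ z, (|fb z - g z| + |c|) ∂ν = ∫ z, |fb z - g z| ∂ν + |c| := by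
        have jj : Integrable (fun z => |fb z - g z|) ν := (jfb.sub jg).abs
        rw [integral_add jj (integrable_const _)]; simp
      have : 0 ≤ M ^ (-(3 + δ)) * K0 := by positivity
      linarith
    have j3 : Integrable (fun z => |h z| ^ 3) ν :=
      Integrable.of_bound (mh.abs.pow_const 3).aestronglyMeasurable ((2 * M) ^ 3)
        (ae_of_all _ fun z => by
          rw [Real.norm_eq_abs, abs_pow, abs_abs]
          exact pow_le_pow_left₀ (abs_nonneg _) (bh z) 3)
    have jd : Integrable (fun z => |h z - fb z|) ν := (jh.sub jfb).abs
    have jm : Integrable (fun z => (1 : ℝ) + |f z| ^ ((4 : ℝ) + δ)) ν :=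
      (integrable_const _).add hmom
    have step : ∫ z, |h z| ^ 3 ∂ν ≤
        ∫ z, (36 * M ^ 2 * |h z - fb z| + 4 * (1 + |f z| ^ ((4 : ℝ) + δ))) ∂ν := by
      refine integral_mono j3 ((jd.const_mul _).add (jm.const_mul _)) fun z => ?_
      simp only
      have t1 : |h z| ≤ |h z - fb z| + |fb z| := by
        have := abs_add_le (h z - fb z) (fb z)
        simpa using this
      have t2 : |h z - fb z| ≤ 3 * M := (abs_sub _ _).trans (by linarith [bh z, bfb z])
      have t3 : |fb z| ≤ |f z| := abs_clip_le_abs hM.le _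
      have t4 : |f z| ^ 3 ≤ 1 + |f z| ^ ((4 : ℝ) + δ) :=
        pow_le_one_add_rpow (abs_nonneg _) hδ 3 (by norm_num)
      have t5 : |h z| ^ 3 ≤ (|h z - fb z| + |fb z|) ^ 3 := pow_le_pow_left₀ (abs_nonneg _) t1 3
      have t6 : (|h z - fb z| + |fb z|) ^ 3 ≤ 4 * (|h z - fb z| ^ 3 + |fb z| ^ 3) := by
        have := add_pow_le (abs_nonneg (h z - fb z)) (abs_nonneg (fb z)) 3
        norm_num at this
        exact this
      have t7 : |fb z| ^ 3 ≤ |f z| ^ 3 := pow_le_pow_left₀ (abs_nonneg _) t3 3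
      have t8 : |h z - fb z| ^ 3 ≤ (3 * M) ^ 2 * |h z - fb z| := by
        rw [pow_succ]
        gcongr
      have t9 : (3 * M) ^ 2 * |h z - fb z| = 9 * M ^ 2 * |h z - fb z| := by ring
      linarith
    refine step.trans ?_
    rw [integral_add (jd.const_mul _) (jm.const_mul _), integral_const_mul, integral_const_mul,
      integral_add (integrable_const _) hmom]
    simp only [integral_const, probReal_univ, smul_eq_mul, one_mul]
    have : 36 * M ^ 2 * ∫ z, |h z - fb z| ∂ν ≤ 36 * M ^ 2 * (2 * b0) := by gcongr
    linarith
  · intro i j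
    have mfi : ∀ i, Measurable fun z => f (shiftZ i z) := fun i => mf.comp (measurable_shiftZ i)
    have mhi : ∀ i, Measurable fun z => h (shiftZ i z) := fun i => mh.comp (measurable_shiftZ i)
    have jsum : Integrable (fun z => (1 + |f (shiftZ i z)| ^ ((4 : ℝ) + δ))
        + (1 + |f (shiftZ j z)| ^ ((4 : ℝ) + δ))) ν :=
      ((integrable_const _).add (shJ i hmom)).add ((integrable_const _).add (shJ j hmom))
    have jff : Integrable (fun z => f (shiftZ i z) * f (shiftZ j z)) ν := by
      refine jsum.mono' ((mfi i).mul (mfi j)).aestronglyMeasurable (ae_of_all _ fun z => ?_)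
      rw [Real.norm_eq_abs, abs_mul]
      have q1 := pow_le_one_add_rpow (abs_nonneg (f (shiftZ i z))) hδ 2 (by norm_num)
      have q2 := pow_le_one_add_rpow (abs_nonneg (f (shiftZ j z))) hδ 2 (by norm_num)
      nlinarith [sq_nonneg (|f (shiftZ i z)| - |f (shiftZ j z)|), sq_nonneg (|f (shiftZ i z)|),
        sq_nonneg (|f (shiftZ j z)|)]
    have jhh : Integrable (fun z => h (shiftZ i z) * h (shiftZ j z)) ν :=
      Integrable.of_bound ((mhi i).mul (mhi j)).aestronglyMeasurable (2 * M * (2 * M))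
        (ae_of_all _ fun z => by
          rw [Real.norm_eq_abs, abs_mul]
          exact mul_le_mul (bh _) (bh _) (abs_nonneg _) (by positivity))
    rw [← integral_sub jff jhh]
    refine (abs_integral_le_integral_abs).trans ?_
    have jd : Integrable (fun z => |f z - h z|) ν := (jf.sub jh).abs
    have jd2 : Integrable (fun z => |f z - fb z|) ν := (jf.sub jfb).abs
    have hb : ∀ z, |f (shiftZ i z) * f (shiftZ j z) - h (shiftZ i z) * h (shiftZ j z)|
        ≤ 2 * M * |f (shiftZ i z) - h (shiftZ i z)| + M * |f (shiftZ j z) - h (shiftZ j z)|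
          + 2 * M * |f (shiftZ i z) - fb (shiftZ i z)|
          + M ^ (-(2 + δ)) * (|f (shiftZ i z)| ^ ((4 : ℝ) + δ)
            + |f (shiftZ j z)| ^ ((4 : ℝ) + δ)) := by
      intro z
      set x := f (shiftZ i z)
      set y := f (shiftZ j z)
      set x' := h (shiftZ i z)
      set y' := h (shiftZ j z)
      set xb := fb (shiftZ i z) with hxb
      have e : x * y - x' * y' = (x - x') * y' + xb * (y - y') + (x - xb) * (y - y') := by ring
      have by' : |y'| ≤ 2 * M := bh _
      have bxb : |xb| ≤ M := bfb _
      have p1 : |(x - x') * y'| ≤ 2 * M * |x - x'| := by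
        rw [abs_mul, mul_comm]; gcongr
      have p2 : |xb * (y - y')| ≤ M * |y - y'| := by
        rw [abs_mul]; gcongr
      have p3 : |(x - xb) * (y - y')| ≤ 2 * M * |x - xb|
          + M ^ (-(2 + δ)) * (|x| ^ ((4 : ℝ) + δ) + |y| ^ ((4 : ℝ) + δ)) := by
        rw [abs_mul]
        have r1 : |y - y'| ≤ |y| + 2 * M := (abs_sub _ _).trans (by linarith)
        have r2 : |x - xb| ≤ M ^ (-(2 + δ)) * |x| ^ (3 + δ) :=
          abs_sub_clip_le hM _ (2 + δ) (3 + δ) (by linarith) (by ring)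
        have r3 := rpow_mul_le |x| |y| (3 + δ) (4 + δ) (abs_nonneg _) (abs_nonneg _)
          (by linarith) (by ring)
        calc |x - xb| * |y - y'| ≤ |x - xb| * (|y| + 2 * M) := by gcongr
          _ = |x - xb| * |y| + 2 * M * |x - xb| := by ring
          _ ≤ M ^ (-(2 + δ)) * |x| ^ (3 + δ) * |y| + 2 * M * |x - xb| := by gcongr
          _ = 2 * M * |x - xb| + M ^ (-(2 + δ)) * (|x| ^ (3 + δ) * |y|) := by ring
          _ ≤ _ := by gcongr
      rw [e]
      refine (abs_add_le _ _).trans ?_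
      have := abs_add_le ((x - x') * y') (xb * (y - y'))
      linarith
    have k1 := (shJ i jd).const_mul (2 * M)
    have k2 := (shJ j jd).const_mul M
    have k3 := (shJ i jd2).const_mul (2 * M)
    have k4 : Integrable (fun z => M ^ (-(2 + δ)) * (|f (shiftZ i z)| ^ ((4 : ℝ) + δ)
            + |f (shiftZ j z)| ^ ((4 : ℝ) + δ))) ν :=
      ((shJ i hmom).add (shJ j hmom)).const_mul _
    have k12 : Integrable (fun z => 2 * M * |f (shiftZ i z) - h (shiftZ i z)|
      + M * |f (shiftZ j z) - h (shiftZ j z)|) ν := k1.add k2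
    have k123 : Integrable (fun z => 2 * M * |f (shiftZ i z) - h (shiftZ i z)|
      + M * |f (shiftZ j z) - h (shiftZ j z)| + 2 * M * |f (shiftZ i z) - fb (shiftZ i z)|) ν :=
      k12.add k3
    have k1234 : Integrable (fun z => 2 * M * |f (shiftZ i z) - h (shiftZ i z)|
      + M * |f (shiftZ j z) - h (shiftZ j z)| + 2 * M * |f (shiftZ i z) - fb (shiftZ i z)|
      + M ^ (-(2 + δ)) * (|f (shiftZ i z)| ^ ((4 : ℝ) + δ)
            + |f (shiftZ j z)| ^ ((4 : ℝ) + δ))) ν :=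
      k123.add k4
    refine (integral_mono (jff.sub jhh).abs k1234 hb).trans ?_
    rw [integral_add k123 k4, integral_add k12 k3, integral_add k1 k2, integral_const_mul,
      integral_const_mul, integral_const_mul, integral_const_mul,
      integral_add (shJ i hmom) (shJ j hmom)]
    have s1 := shI i (mf.sub mh).abs
    have s2 := shI j (mf.sub mh).abs
    have s3 := shI i (mf.sub mfb).abs
    have s4 := shI i (mf.abs.pow_const ((4 : ℝ) + δ))
    have s5 := shI j (mf.abs.pow_const ((4 : ℝ) + δ))
    simp only [Pi.sub_apply] at s1 s2 s3 s4 s5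
    rw [s1, s2, s3, s4, s5]
    have MM : M * M ^ (-(3 + δ)) = M ^ (-(2 + δ)) := by
      conv_lhs => rw [← Real.rpow_one_add' hM.le (by linarith)]
      congr 1; ring
    have z1 : 2 * M * ∫ z, |f z - h z| ∂ν ≤ 2 * M * (2 * b0) := by gcongr
    have z2 : M * ∫ z, |f z - h z| ∂ν ≤ M * (2 * b0) := by gcongr
    have z3 : 2 * M * ∫ z, |f z - fb z| ∂ν ≤ 2 * (M ^ (-(2 + δ)) * K0) := by
      calc _ ≤ 2 * M * (M ^ (-(3 + δ)) * K0) := by gcongr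
        _ = 2 * ((M * M ^ (-(3 + δ))) * K0) := by ring
        _ = _ := by rw [MM]
    have z4 : M ^ (-(2 + δ)) * (∫ z, |f z| ^ ((4 : ℝ) + δ) ∂ν + ∫ z, |f z| ^ ((4 : ℝ) + δ) ∂ν)
        ≤ M ^ (-(2 + δ)) * (K0 + K0) := by gcongr
    linarith

/-- block sums of the shifted functional -/
def blk (h : (ℤ → ℝ) → ℝ) (r p : ℕ) (z : ℤ → ℝ) : ℝ :=
  ∑ i ∈ Finset.range p, h (shiftZ ((r : ℤ) + i + 1) z)

lemma measurable_blk {h : (ℤ → ℝ) → ℝ} (mh : Measurable h) (r p : ℕ) : Measurable (blk h r p) :=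
  Finset.measurable_sum _ fun i _ => mh.comp (measurable_shiftZ _)

lemma blk_add (h : (ℤ → ℝ) → ℝ) (r p q : ℕ) (z : ℤ → ℝ) :
    blk h r (p + q) z = blk h r p z + blk h (r + p) q z := by
  unfold blk
  rw [Finset.sum_range_add]
  congr 1
  refine Finset.sum_congr rfl fun i _ => ?_
  push_cast
  congr 2
  ring

lemma blk_succ (h : (ℤ → ℝ) → ℝ) (r p : ℕ) (z : ℤ → ℝ) :
    blk h r (p + 1) z = blk h r p z + h (shiftZ ((r : ℤ) + p + 1) z) := by
  unfold blk
  rw [Finset.sum_range_succ]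

lemma abs_blk_le (h : (ℤ → ℝ) → ℝ) (r p : ℕ) (z : ℤ → ℝ) :
    |blk h r p z| ≤ blk (fun z => |h z|) r p z := Finset.abs_sum_le_sum_abs _ _

lemma dependsOn_blk {h : (ℤ → ℝ) → ℝ} {S T : Set ℤ} (dh : DependsOn h S) (r p : ℕ)
    (hT : ∀ i : ℕ, i < p → ∀ s ∈ S, (r : ℤ) + i + 1 + s ∈ T) : DependsOn (blk h r p) T := by
  intro x y hxy
  unfold blk
  refine Finset.sum_congr rfl fun i hi => ?_
  exact DependsOn.shiftZ dh _ (hT i (Finset.mem_range.1 hi)) hxy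

lemma abs_le_one_add_cube (x : ℝ) : |x| ≤ 1 + |x| ^ 3 := by
  have := abs_nonneg x
  nlinarith [mul_nonneg this (sq_nonneg (|x| - 1)), sq_nonneg (|x| - 1), mul_nonneg this this]

section
variable {Ω : Type*} [MeasurableSpace Ω] (μ : Measure Ω) [IsProbabilityMeasure μ]
  (Z : ℤ → Ω → ℝ)

/-- half the truncated long run variance -/
def vv (h : (ℤ → ℝ) → ℝ) (p : ℕ) : ℝ :=
  (∫ z, h (shiftZ 0 z) * h (shiftZ 0 z) ∂(pathLaw μ Z)) / 2
    + ∑ i ∈ Finset.range p, ∫ z, h (shiftZ 0 z) * h (shiftZ ((i : ℤ) + 1) z) ∂(pathLaw μ Z)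

lemma cov_shift (hZ : ∀ t, Measurable (Z t)) (hs : Stationary μ Z) {h : (ℤ → ℝ) → ℝ}
    (mh : Measurable h) (s t : ℤ) :
    ∫ z, h (shiftZ s z) * h (shiftZ t z) ∂(pathLaw μ Z)
      = ∫ z, h (shiftZ 0 z) * h (shiftZ (t - s) z) ∂(pathLaw μ Z) := by
  have := integral_shiftZ hZ hs s (F := fun z => h (shiftZ 0 z) * h (shiftZ (t - s) z))
    ((mh.comp (measurable_shiftZ _)).mul (mh.comp (measurable_shiftZ _)))
  rw [← this]
  congr 1
  ext z
  rw [shiftZ_shiftZ, shiftZ_shiftZ]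
  simp

lemma integral_y_N (hZ : ∀ t, Measurable (Z t)) (hs : Stationary μ Z) {h : (ℤ → ℝ) → ℝ}
    (mh : Measurable h) (B : ℝ) (hB : ∀ z, |h z| ≤ B) (r p : ℕ) :
    ∫ z, h (shiftZ ((r : ℤ) + p + 1) z) * (blk h r p z + h (shiftZ ((r : ℤ) + p + 1) z) / 2)
      ∂(pathLaw μ Z) = vv μ Z h p := by
  have := isProb_pathLaw μ Z hZ
  have jhh : ∀ i j, Integrable (fun z => h (shiftZ i z) * h (shiftZ j z)) (pathLaw μ Z) := by
    intro i j
    refine Integrable.of_bound ((mh.comp (measurable_shiftZ _)).mul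
      (mh.comp (measurable_shiftZ _))).aestronglyMeasurable (B * B) (ae_of_all _ fun z => ?_)
    rw [Real.norm_eq_abs, abs_mul]
    exact mul_le_mul (hB _) (hB _) (abs_nonneg _) ((abs_nonneg _).trans (hB z))
  have e : ∀ z, h (shiftZ ((r : ℤ) + p + 1) z)
      * (blk h r p z + h (shiftZ ((r : ℤ) + p + 1) z) / 2)
      = (∑ i ∈ Finset.range p, h (shiftZ ((r : ℤ) + i + 1) z) * h (shiftZ ((r : ℤ) + p + 1) z))
        + (h (shiftZ ((r : ℤ) + p + 1) z) * h (shiftZ ((r : ℤ) + p + 1) z)) / 2 := by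
    intro z
    rw [← Finset.sum_mul]
    unfold blk
    ring
  simp_rw [e]
  rw [integral_add (integrable_finsetSum _ fun i _ => jhh _ _) ((jhh _ _).div_const 2),
    integral_finsetSum _ fun i _ => jhh _ _, integral_div, cov_shift μ Z hZ hs mh]
  unfold vv
  rw [add_comm]
  congr 1
  · simp
  rw [← Finset.sum_range_reflect]
  refine Finset.sum_congr rfl fun i hi => ?_
  rw [cov_shift μ Z hZ hs mh]
  have hi := Finset.mem_range.1 hi
  have : (r : ℤ) + p + 1 - ((r : ℤ) + (p - 1 - i : ℕ) + 1) = i + 1 := by omega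
  rw [this]

/-- the basic recursion step -/
lemma step_mix (hZ : ∀ t, Measurable (Z t)) (hs : Stationary μ Z) {h : (ℤ → ℝ) → ℝ}
    (mh : Measurable h) (m p : ℕ) (hm : 1 ≤ m) (hp : p + 1 = 3 * m)
    (dh : DependsOn h (Set.Icc (-(m : ℤ)) m)) (M : ℝ) (hM : 0 < M)
    (hB : ∀ z, |h z| ≤ 2 * M) (h0 : ∫ z, h z ∂(pathLaw μ Z) = 0) (K : ℝ)
    (hK : ∫ z, (1 + |h z| ^ 3) ∂(pathLaw μ Z) ≤ K) (c : ℝ) (r : ℕ) :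
    ‖∫ z, ex (c * blk h 0 (r + 3 * m + p + 1) z) ∂(pathLaw μ Z)
      - ((1 - c ^ 2 * vv μ Z h p : ℝ) : ℂ) * ∫ z, ex (c * blk h 0 (r + 3 * m + p) z) ∂(pathLaw μ Z)‖
    ≤ 4 * |c| ^ 3 * (72 * m ^ 2 * K) + |c| * (2 * (2 * M) * betaMix μ Z m)
      + c ^ 2 * (2 * (12 * m * M ^ 2) * betaMix μ Z m) + |c| ^ 3 * (6 * m * K) * |vv μ Z h p| := by
  have := isProb_pathLaw μ Z hZ
  set ν := pathLaw μ Z with hν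
  set w := blk h 0 (r + 3 * m + p) with hw
  set y : (ℤ → ℝ) → ℝ := fun z => h (shiftZ (((r + 3 * m : ℕ) : ℤ) + p + 1) z) with hy
  set N := blk h (r + 3 * m) p with hN
  set N' := blk h r (3 * m) with hN'
  set A := blk (fun z => |h z|) r (6 * m) with hA
  have m3 : Measurable fun z => |h z| ^ 3 := mh.abs.pow_const 3
  have j3 : Integrable (fun z => |h z| ^ 3) ν :=
    Integrable.of_bound m3.aestronglyMeasurable ((2 * M) ^ 3)
      (ae_of_all _ fun z => by
        rw [Real.norm_eq_abs, abs_pow, abs_abs]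
        exact pow_le_pow_left₀ (abs_nonneg _) (hB z) 3)
  have j1 : Integrable (fun z => |h z|) ν :=
    Integrable.of_bound mh.abs.aestronglyMeasurable (2 * M) (ae_of_all _ fun z => by
        rw [Real.norm_eq_abs, abs_abs]; exact hB z)
  have j13 : Integrable (fun z => 1 + |h z| ^ 3) ν := (integrable_const _).add j3
  have E1 : ∫ z, |h z| ∂ν ≤ K :=
    (integral_mono j1 j13 fun z => abs_le_one_add_cube (h z)).trans hK
  have E3 : ∫ z, |h z| ^ 3 ∂ν ≤ K :=
    (integral_mono j3 j13 fun z => by simp).trans hK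
  have hK0 : 0 ≤ K := (integral_nonneg fun z => abs_nonneg _).trans E1
  have my : Measurable y := mh.comp (measurable_shiftZ _)
  have mw : Measurable w := measurable_blk mh _ _
  have mN : Measurable N := measurable_blk mh _ _
  have mN' : Measurable N' := measurable_blk mh _ _
  have mA : Measurable A := measurable_blk mh.abs _ _
  have by0 : ∀ z, |y z| ≤ 2 * M := fun z => hB _
  have hA0 : ∀ z, 0 ≤ A z := fun z => Finset.sum_nonneg fun i _ => abs_nonneg _
  have bA : ∀ z, |A z| ≤ 6 * m * (2 * M) := by
    intro z
    rw [abs_of_nonneg (hA0 z)]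
    refine (Finset.sum_le_card_nsmul _ _ (2 * M) fun i _ => hB _).trans ?_
    simp
  have eA : ∀ z, A z = blk (fun z => |h z|) r (3 * m) z + blk (fun z => |h z|) (r + 3 * m) p z
      + |y z| := by
    intro z
    have : 6 * m = 3 * m + (p + 1) := by omega
    rw [hA, this, blk_add, blk_succ]
    ring
  have hAle : ∀ z, |y z| + |N z| + |N' z| ≤ A z := by
    intro z
    rw [eA]
    have := abs_blk_le h r (3 * m) z
    have := abs_blk_le h (r + 3 * m) p z
    linarith
  have iy : Integrable y ν :=
    Integrable.of_bound my.aestronglyMeasurable (2 * M) (ae_of_all _ by0)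
  have iA : Integrable A ν :=
    Integrable.of_bound mA.aestronglyMeasurable (6 * m * (2 * M)) (ae_of_all _ bA)
  have bN : ∀ z, |N z| ≤ p * (2 * M) := by
    intro z
    refine (abs_blk_le _ _ _ _).trans ?_
    refine (Finset.sum_le_card_nsmul _ _ (2 * M) fun i _ => hB _).trans ?_
    simp
  have bq : ∀ z, |y z * (N z + y z / 2)| ≤ 12 * m * M ^ 2 := by
    intro z
    rw [abs_mul]
    have hp' : (p : ℝ) + 1 = 3 * m := by exact_mod_cast hp
    have : |N z + y z / 2| ≤ p * (2 * M) + M := by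
      refine (abs_add_le _ _).trans ?_
      rw [abs_div, abs_two]
      have := bN z
      have := by0 z
      linarith
    calc |y z| * |N z + y z / 2| ≤ (2 * M) * (p * (2 * M) + M) := by
          have := by0 z; gcongr
      _ ≤ (2 * M) * (3 * m * (2 * M)) := by
          rw [← hp']; gcongr; nlinarith
      _ = _ := by ring
  have iq : Integrable (fun z => y z * (N z + y z / 2)) ν :=
    Integrable.of_bound (my.mul (mN.add (my.div_const 2))).aestronglyMeasurable _ (ae_of_all _ bq)
  have iA2 : Integrable (fun z => |y z| * A z ^ 2) ν := by
    refine Integrable.of_bound (my.abs.mul (mA.pow_const 2)).aestronglyMeasurable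
      ((2 * M) * (6 * m * (2 * M)) ^ 2) (ae_of_all _ fun z => ?_)
    rw [Real.norm_eq_abs, abs_mul, abs_abs, abs_pow]
    have := by0 z
    have := bA z
    gcongr
  -- moments
  have shE : ∀ (t : ℤ) {F : (ℤ → ℝ) → ℝ}, Measurable F → ∫ z, F (shiftZ t z) ∂ν = ∫ z, F z ∂ν :=
    fun t F hF => integral_shiftZ hZ hs t hF
  have shJ : ∀ (t : ℤ) {F : (ℤ → ℝ) → ℝ}, Integrable F ν →
      Integrable (fun z => F (shiftZ t z)) ν := fun t F hF =>
    (mp_shiftZ μ Z hZ hs t).integrable_comp_of_integrable hF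
  have D1 : ∫ z, A z ∂ν ≤ 6 * m * K := by
    rw [hA]
    unfold blk
    rw [integral_finsetSum _ fun i _ => shJ _ j1]
    refine (Finset.sum_le_card_nsmul _ _ K fun i _ => ?_).trans ?_
    · rw [shE _ mh.abs]; exact E1
    · simp
  have D3 : ∫ z, |y z| * A z ^ 2 ∂ν ≤ 72 * m ^ 2 * K := by
    have jj : ∀ i : ℕ, Integrable (fun z => |y z| ^ 3 + |h (shiftZ ((r : ℤ) + i + 1) z)| ^ 3) ν :=
      fun i => (shJ _ j3).add (shJ _ j3)
    have : ∫ z, |y z| * A z ^ 2 ∂ν ≤ ∫ z, (6 * m : ℝ) * ∑ i ∈ Finset.range (6 * m),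
        (|y z| ^ 3 + |h (shiftZ ((r : ℤ) + i + 1) z)| ^ 3) ∂ν := by
      refine integral_mono iA2 ((integrable_finsetSum _ fun i _ => jj i).const_mul _) fun z => ?_
      simp only
      have c1 : A z ^ 2 ≤ (6 * m : ℝ) * ∑ i ∈ Finset.range (6 * m),
          |h (shiftZ ((r : ℤ) + i + 1) z)| ^ 2 := by
        have := sq_sum_le_card_mul_sum_sq (s := Finset.range (6 * m))
          (f := fun i : ℕ => |h (shiftZ ((r : ℤ) + i + 1) z)|)
        rw [Finset.card_range] at this
        push_cast at this
        exact this
      calc |y z| * A z ^ 2 ≤ |y z| * ((6 * m : ℝ) * ∑ i ∈ Finset.range (6 * m),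
          |h (shiftZ ((r : ℤ) + i + 1) z)| ^ 2) := by gcongr
        _ = (6 * m : ℝ) * ∑ i ∈ Finset.range (6 * m),
          |y z| * |h (shiftZ ((r : ℤ) + i + 1) z)| ^ 2 := by rw [← Finset.mul_sum]; ring
        _ ≤ _ := by
          gcongr with i _
          have a0 := abs_nonneg (y z)
          have b0 := abs_nonneg (h (shiftZ ((r : ℤ) + i + 1) z))
          set α := |y z|
          set b := |h (shiftZ ((r : ℤ) + i + 1) z)|
          rcases le_total α b with hab | hab
          · have : α * b ^ 2 ≤ b * b ^ 2 := by gcongr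
            have : 0 ≤ α ^ 3 := by positivity
            nlinarith
          · have : α * b ^ 2 ≤ α * α ^ 2 := by gcongr
            have : 0 ≤ b ^ 3 := by positivity
            nlinarith
    refine this.trans ?_
    rw [integral_const_mul, integral_finsetSum _ fun i _ => jj i]
    have : ∑ i ∈ Finset.range (6 * m), ∫ z, (|y z| ^ 3 + |h (shiftZ ((r : ℤ) + i + 1) z)| ^ 3) ∂ν
        ≤ 6 * m * (2 * K) := by
      refine (Finset.sum_le_card_nsmul _ _ (2 * K) fun i _ => ?_).trans ?_
      · have := integral_add (shJ (((r + 3 * m : ℕ) : ℤ) + p + 1) j3) (shJ ((r : ℤ) + i + 1) j3)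
        rw [this, shE _ m3, shE _ m3]
        linarith
      · simp
    calc _ ≤ (6 * m : ℝ) * (6 * m * (2 * K)) := by gcongr
      _ = _ := by ring
  have hv : ∫ z, y z * (N z + y z / 2) ∂ν = vv μ Z h p :=
    integral_y_N μ Z hZ hs mh (2 * M) hB (r + 3 * m) p
  have Ey : ∫ z, y z ∂ν = 0 := (shE _ mh).trans h0
  have wN : ∀ z, w z - N z = blk h 0 (r + 3 * m) z := by
    intro z
    rw [hw, hN, blk_add]
    simp
  have wNN : ∀ z, w z - N z - N' z = blk h 0 r z := by
    intro z
    rw [wN, hN', blk_add]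
    simp
  have dy : DependsOn y (Set.Ici ((r : ℤ) + 5 * m)) := by
    refine DependsOn.shiftZ dh _ fun i hi => ?_
    simp only [Set.mem_Icc, Set.mem_Ici] at hi ⊢
    push_cast
    omega
  have H1 : ‖∫ z, ex (c * (w z - N z)) * (y z : ℂ) ∂ν‖ ≤ 2 * (2 * M) * betaMix μ Z m := by
    have dF : DependsOn (fun z => c * blk h 0 (r + 3 * m) z)
        (Set.Icc (1 - (m : ℤ)) (r + 4 * m)) := by
      have : DependsOn (blk h 0 (r + 3 * m)) (Set.Icc (1 - (m : ℤ)) (r + 4 * m)) := by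
        refine dependsOn_blk dh 0 _ fun i hi s hs => ?_
        simp only [Set.mem_Icc] at hs ⊢
        push_cast
        omega
      intro x y hxy
      simp only [this hxy]
    have := cov_path_exp μ Z hZ hs m (1 - (m : ℤ)) (r + 4 * m) (r + 5 * m) (by omega) (by omega)
      (fun z => c * blk h 0 (r + 3 * m) z) y ((measurable_blk mh _ _).const_mul c) my dF dy
      (2 * M) (by linarith) by0
    rw [Ey] at this
    simp only [Complex.ofReal_zero, mul_zero, sub_zero] at this
    simp_rw [wN]
    exact this
  have H2 : ‖∫ z, ex (c * (w z - N z - N' z)) * ((y z * (N z + y z / 2) : ℝ) : ℂ) ∂ν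
      - (∫ z, ex (c * (w z - N z - N' z)) ∂ν) * ((∫ z, y z * (N z + y z / 2) ∂ν : ℝ) : ℂ)‖
      ≤ 2 * (12 * m * M ^ 2) * betaMix μ Z m := by
    have dF : DependsOn (fun z => c * blk h 0 r z)
        (Set.Icc (1 - (m : ℤ)) (r + m)) := by
      have : DependsOn (blk h 0 r) (Set.Icc (1 - (m : ℤ)) (r + m)) := by
        refine dependsOn_blk dh 0 _ fun i hi s hs => ?_
        simp only [Set.mem_Icc] at hs ⊢
        push_cast
        omega
      intro x y hxy
      simp only [this hxy]
    have dG : DependsOn (fun z => y z * (N z + y z / 2)) (Set.Ici ((r : ℤ) + 2 * m)) := by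
      have d1 : DependsOn N (Set.Ici ((r : ℤ) + 2 * m)) := by
        refine dependsOn_blk dh _ _ fun i hi s hs => ?_
        simp only [Set.mem_Icc, Set.mem_Ici] at hs ⊢
        push_cast
        omega
      intro x x' hxy
      have e1 : y x = y x' := dy fun i hi => hxy i (by
        simp only [Set.mem_Ici] at hi ⊢; omega)
      have e2 : N x = N x' := d1 hxy
      simp only [e1, e2]
    have := cov_path_exp μ Z hZ hs m (1 - (m : ℤ)) (r + m) (r + 2 * m) (by omega) (by omega)
      (fun z => c * blk h 0 r z) (fun z => y z * (N z + y z / 2))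
      ((measurable_blk mh _ _).const_mul c) (my.mul (mN.add (my.div_const 2))) dF dG
      (12 * m * M ^ 2) (by positivity) bq
    simp_rw [wNN]
    exact this
  have := step_lemma ν c w y N N' A mw my mN mN' hAle iy iA iq iA2 (6 * m * K) |vv μ Z h p|
    (72 * m ^ 2 * K) _ _ D1 D3 (by rw [hv]) H1 H2
  rw [hv] at this
  have e : ∀ z, blk h 0 (r + 3 * m + p + 1) z = w z + y z := by
    intro z
    rw [blk_succ, hw, hy]
    simp
  simp_rw [e]
  exact this

lemma step_low (hZ : ∀ t, Measurable (Z t)) (hs : Stationary μ Z) {h : (ℤ → ℝ) → ℝ}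
    (mh : Measurable h) (jh : Integrable h (pathLaw μ Z)) (K : ℝ)
    (hK : ∫ z, |h z| ∂(pathLaw μ Z) ≤ K) (c v : ℝ) (j : ℕ) :
    ‖∫ z, ex (c * blk h 0 (j + 1) z) ∂(pathLaw μ Z)
      - ((1 - c ^ 2 * v : ℝ) : ℂ) * ∫ z, ex (c * blk h 0 j z) ∂(pathLaw μ Z)‖
    ≤ |c| * K + c ^ 2 * |v| := by
  have := isProb_pathLaw μ Z hZ
  set ν := pathLaw μ Z with hν
  have ij : ∀ j, Integrable (fun z => ex (c * blk h 0 j z)) ν := fun j =>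
    integrable_ex ν ((measurable_blk mh _ _).const_mul c)
  have n1 : ∀ j, ‖∫ z, ex (c * blk h 0 j z) ∂ν‖ ≤ 1 := by
    intro j
    have := norm_integral_le_of_norm_le_const (μ := ν) (f := fun z => ex (c * blk h 0 j z)) (C := 1)
      (ae_of_all _ fun z => (norm_ex _).le)
    simpa using this
  have n2 : ‖∫ z, ex (c * blk h 0 (j + 1) z) ∂ν - ∫ z, ex (c * blk h 0 j z) ∂ν‖ ≤ |c| * K := by
    rw [← integral_sub (ij _) (ij _)]
    have jy := (mp_shiftZ μ Z hZ hs (((0 : ℕ) : ℤ) + j + 1)).integrable_comp_of_integrable jh.abs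
    refine (norm_integral_le_of_norm_le (jy.const_mul |c|) (ae_of_all _ fun z => ?_)).trans ?_
    · refine (norm_ex_sub _ _).trans ?_
      rw [blk_succ, ← mul_sub, abs_mul]
      simp [Function.comp]
    · rw [integral_const_mul]
      have := integral_shiftZ hZ hs (((0 : ℕ) : ℤ) + j + 1) mh.abs
      simp only [Function.comp]
      rw [this]
      gcongr
  have e : ∫ z, ex (c * blk h 0 (j + 1) z) ∂ν
      - ((1 - c ^ 2 * v : ℝ) : ℂ) * ∫ z, ex (c * blk h 0 j z) ∂ν
      = (∫ z, ex (c * blk h 0 (j + 1) z) ∂ν - ∫ z, ex (c * blk h 0 j z) ∂ν)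
        + ((c ^ 2 * v : ℝ) : ℂ) * ∫ z, ex (c * blk h 0 j z) ∂ν := by
    push_cast; ring
  rw [e]
  refine (norm_add_le _ _).trans (add_le_add n2 ?_)
  rw [norm_mul, Complex.norm_real, Real.norm_eq_abs, abs_mul, abs_of_nonneg (sq_nonneg c)]
  calc _ ≤ c ^ 2 * |v| * 1 := by gcongr; exact n1 j
    _ = _ := mul_one _

/-- the accumulated bound -/
lemma chain_mix (hZ : ∀ t, Measurable (Z t)) (hs : Stationary μ Z) {h : (ℤ → ℝ) → ℝ}
    (mh : Measurable h) (m p : ℕ) (hm : 1 ≤ m) (hp : p + 1 = 3 * m)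
    (dh : DependsOn h (Set.Icc (-(m : ℤ)) m)) (M : ℝ) (hM : 0 < M)
    (hB : ∀ z, |h z| ≤ 2 * M) (h0 : ∫ z, h z ∂(pathLaw μ Z) = 0) (K : ℝ)
    (hK : ∫ z, (1 + |h z| ^ 3) ∂(pathLaw μ Z) ≤ K) (c : ℝ) (n : ℕ) :
    ‖∫ z, ex (c * blk h 0 n z) ∂(pathLaw μ Z) - ((1 - c ^ 2 * vv μ Z h p : ℝ) : ℂ) ^ n‖
    ≤ (1 + c ^ 2 * |vv μ Z h p|) ^ n * (n * (4 * |c| ^ 3 * (72 * m ^ 2 * K)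
      + |c| * (2 * (2 * M) * betaMix μ Z m)
      + c ^ 2 * (2 * (12 * m * M ^ 2) * betaMix μ Z m) + |c| ^ 3 * (6 * m * K) * |vv μ Z h p|)
      + (6 * m : ℕ) * (|c| * K + c ^ 2 * |vv μ Z h p|)) := by
  have := isProb_pathLaw μ Z hZ
  have j3 : Integrable (fun z => |h z| ^ 3) (pathLaw μ Z) :=
    Integrable.of_bound (mh.abs.pow_const 3).aestronglyMeasurable ((2 * M) ^ 3)
      (ae_of_all _ fun z => by
        rw [Real.norm_eq_abs, abs_pow, abs_abs]
        exact pow_le_pow_left₀ (abs_nonneg _) (hB z) 3)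
  have jh : Integrable h (pathLaw μ Z) :=
    Integrable.of_bound mh.aestronglyMeasurable (2 * M) (ae_of_all _ fun z => hB z)
  have j13 : Integrable (fun z => 1 + |h z| ^ 3) (pathLaw μ Z) := (integrable_const _).add j3
  have E1 : ∫ z, |h z| ∂(pathLaw μ Z) ≤ K :=
    (integral_mono jh.abs j13 fun z => abs_le_one_add_cube (h z)).trans hK
  have hK0 : 0 ≤ K := (integral_nonneg fun z => abs_nonneg _).trans E1
  have hβ := betaMix_nonneg μ Z m
  refine chain_lemma (fun j => ∫ z, ex (c * blk h 0 j z) ∂(pathLaw μ Z)) _ _ _ _ (6 * m)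
    ?_ ?_ ?_ ?_ ?_ ?_ ?_ n
  · have : 0 ≤ c ^ 2 * |vv μ Z h p| := by positivity
    linarith
  · rw [Complex.norm_real, Real.norm_eq_abs]
    refine (abs_sub _ _).trans ?_
    rw [abs_one, abs_mul, abs_of_nonneg (sq_nonneg c)]
  · positivity
  · positivity
  · simp [blk, ex_zero]
  · intro j _
    exact step_low μ Z hZ hs mh jh K E1 c _ j
  · intro j hj
    obtain ⟨r, rfl⟩ : ∃ r, j = r + 3 * m + p := ⟨j - (3 * m + p), by omega⟩
    exact step_mix μ Z hZ hs mh m p hm hp dh M hM hB h0 K hK c r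
end

lemma le_rpow_of_sq_mul_le {a p x : ℝ} (ha : 0 ≤ a) (hp : 0 < p) (hx : 0 < x)
    (h : x ^ 2 * a ^ p ≤ 1) : a ≤ x ^ (-(2 / p)) := by
  have h1 : a ^ p ≤ x ^ (-2 : ℝ) := by
    have e : x ^ (-2 : ℝ) = (x ^ 2)⁻¹ := by rw [Real.rpow_neg hx.le]; norm_num
    rw [e, ← one_div, le_div_iff₀ (by positivity)]
    linarith
  have h2 := Real.rpow_le_rpow (Real.rpow_nonneg ha p) h1 (inv_pos.2 hp).le
  rw [Real.rpow_rpow_inv ha hp.ne', ← Real.rpow_mul hx.le] at h2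
  convert h2 using 2
  ring

lemma ev_bound (a β : ℕ → ℝ) (ha : ∀ k, 0 ≤ a k) (hβ : ∀ k, 0 ≤ β k) (d : ℕ) (δ : ℝ) (hδ : 0 < δ)
    (hsum : Summable (fun k : ℕ => ((d + k : ℕ) : ℝ) ^ 2 *
      (a (d + k) ^ (δ / (3 + δ)) + β (d + k) ^ (δ / (4 + δ))))) :
    ∀ᶠ m : ℕ in atTop, a m ≤ (m : ℝ) ^ (-(2 + 3 * (2 / δ))) ∧ β m ≤ (m : ℝ) ^ (-(2 + 4 * (2 / δ))) := by
  have h1 := hsum.tendsto_atTop_zero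
  have h2 : Tendsto (fun m : ℕ => (m : ℝ) ^ 2 *
      (a m ^ (δ / (3 + δ)) + β m ^ (δ / (4 + δ)))) atTop (nhds 0) := by
    rw [← tendsto_add_atTop_iff_nat d]
    simpa only [add_comm] using h1
  filter_upwards [h2.eventually_le_const (zero_lt_one), eventually_ge_atTop 1] with m hm hm1
  have hm0 : (0 : ℝ) < m := by exact_mod_cast hm1
  have pa : 0 ≤ a m ^ (δ / (3 + δ)) := Real.rpow_nonneg (ha m) _
  have pb : 0 ≤ β m ^ (δ / (4 + δ)) := Real.rpow_nonneg (hβ m) _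
  have hm2 : (0 : ℝ) ≤ (m : ℝ) ^ 2 := by positivity
  constructor
  · have := le_rpow_of_sq_mul_le (ha m) (p := δ / (3 + δ)) (by positivity) hm0 (by nlinarith)
    convert this using 2
    field_simp
    ring
  · have := le_rpow_of_sq_mul_le (hβ m) (p := δ / (4 + δ)) (by positivity) hm0 (by nlinarith)
    convert this using 2
    field_simp
    ring

section
variable {Ω : Type*} [MeasurableSpace Ω] (μ : Measure Ω) [IsProbabilityMeasure μ]
  (Z : ℤ → Ω → ℝ)

/-- what is needed from the approximating family -/
def GoodApprox (f : (ℤ → ℝ) → ℝ) (α C K : ℝ) (m : ℕ) (h : (ℤ → ℝ) → ℝ) : Prop :=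
  Measurable h ∧ DependsOn h (Set.Icc (-(m : ℤ)) m) ∧ (∀ z, |h z| ≤ 2 * (m : ℝ) ^ α) ∧
  ∫ z, h z ∂(pathLaw μ Z) = 0 ∧
  ∫ z, |f z - h z| ∂(pathLaw μ Z) ≤ C * (m : ℝ) ^ (-(2 + 3 * α)) ∧
  ∫ z, (1 + |h z| ^ 3) ∂(pathLaw μ Z) ≤ K ∧
  ∀ i j, |∫ z, f (shiftZ i z) * f (shiftZ j z) ∂(pathLaw μ Z)
    - ∫ z, h (shiftZ i z) * h (shiftZ j z) ∂(pathLaw μ Z)| ≤ C * (m : ℝ) ^ (-(2 + 2 * α))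

lemma exists_good (hZ : ∀ t, Measurable (Z t)) (hs : Stationary μ Z) (f : (ℤ → ℝ) → ℝ)
    (mf : Measurable f) (jf : Integrable f (pathLaw μ Z)) (hmean : ∫ z, f z ∂(pathLaw μ Z) = 0)
    (δ : ℝ) (hδ : 0 < δ) (hmom : Integrable (fun z => |f z| ^ ((4 : ℝ) + δ)) (pathLaw μ Z))
    (K0 : ℝ) (hK : ∫ z, |f z| ^ ((4 : ℝ) + δ) ∂(pathLaw μ Z) ≤ K0) (m : ℕ) (hm : 1 ≤ m) (a : ℝ)
    (ham : a ≤ (m : ℝ) ^ (-(2 + 3 * (2 / δ))))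
    (hwin : ∃ h, Measurable h ∧ DependsOn h (Set.Icc (-(m : ℤ)) m) ∧ Integrable h (pathLaw μ Z) ∧
      ∫ z, |f z - h z| ∂(pathLaw μ Z) ≤ a) :
    ∃ h, GoodApprox μ Z f (2 / δ) (10 * (1 + K0)) (1 + 76 * (1 + K0)) m h := by
  have := isProb_pathLaw μ Z hZ
  obtain ⟨h0, mh0, d0, i0, ha⟩ := hwin
  have hx : (1 : ℝ) ≤ m := by exact_mod_cast hm
  have hx0 : (0 : ℝ) < m := by linarith
  have hK0 : 0 ≤ K0 := (integral_nonneg fun z => by positivity).trans hK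
  set α := 2 / δ with hα
  have hαp : 0 < α := by positivity
  have hαδ : α * δ = 2 := by rw [hα]; field_simp
  set x : ℝ := (m : ℝ) with hxdef
  obtain ⟨h, mh, dh, bh, e0, e1, e3, ec⟩ := approximant (pathLaw μ Z)
    (fun t => mp_shiftZ μ Z hZ hs t) f mf jf hmean δ hδ hmom K0 hK _ h0 mh0 d0 i0 a ha (x ^ α)
    (by positivity)
  have p1 : (x ^ α) ^ (-(3 + δ)) = x ^ (-(2 + 3 * α)) := by
    rw [← Real.rpow_mul hx0.le]; congr 1; linear_combination -hαδ
  have p2 : (x ^ α) ^ (-(2 + δ)) = x ^ (-(2 + 2 * α)) := by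
    rw [← Real.rpow_mul hx0.le]; congr 1; linear_combination -hαδ
  have p3 : x ^ α * x ^ (-(2 + 3 * α)) = x ^ (-(2 + 2 * α)) := by
    rw [← Real.rpow_add hx0]; congr 1; ring
  have p4 : (x ^ α) ^ 2 * x ^ (-(2 + 3 * α)) = x ^ (-(2 + α)) := by
    rw [← Real.rpow_natCast, ← Real.rpow_mul hx0.le, ← Real.rpow_add hx0]; congr 1; push_cast; ring
  have p5 : x ^ (-(2 + α)) ≤ 1 := Real.rpow_le_one_of_one_le_of_nonpos hx (by linarith)
  rw [p1] at e1 e3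
  rw [p1, p2] at ec
  have hb : a + x ^ (-(2 + 3 * α)) * K0 ≤ (1 + K0) * x ^ (-(2 + 3 * α)) := by linarith
  have q1 : 0 < x ^ (-(2 + 3 * α)) := by positivity
  have q2 : 0 < x ^ (-(2 + 2 * α)) := by positivity
  refine ⟨h, mh, dh, bh, e0, ?_, ?_, ?_⟩
  · refine e1.trans ?_
    nlinarith [mul_nonneg hK0 q1.le]
  · have j3 : Integrable (fun z => |h z| ^ 3) (pathLaw μ Z) :=
      Integrable.of_bound (mh.abs.pow_const 3).aestronglyMeasurable ((2 * x ^ α) ^ 3)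
        (ae_of_all _ fun z => by
          rw [Real.norm_eq_abs, abs_pow, abs_abs]
          exact pow_le_pow_left₀ (abs_nonneg _) (bh z) 3)
    rw [integral_add (integrable_const _) j3]
    simp only [integral_const, probReal_univ, smul_eq_mul, one_mul]
    have : 72 * (x ^ α) ^ 2 * (a + x ^ (-(2 + 3 * α)) * K0)
        ≤ 72 * (1 + K0) := by
      calc _ ≤ 72 * (x ^ α) ^ 2 * ((1 + K0) * x ^ (-(2 + 3 * α))) := by gcongr
        _ = 72 * (1 + K0) * ((x ^ α) ^ 2 * x ^ (-(2 + 3 * α))) := by ring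
        _ = 72 * (1 + K0) * x ^ (-(2 + α)) := by rw [p4]
        _ ≤ 72 * (1 + K0) * 1 := by gcongr
        _ = _ := mul_one _
    linarith
  · intro i j
    refine (ec i j).trans ?_
    have : 6 * x ^ α * (a + x ^ (-(2 + 3 * α)) * K0) ≤ 6 * (1 + K0) * x ^ (-(2 + 2 * α)) := by
      calc _ ≤ 6 * x ^ α * ((1 + K0) * x ^ (-(2 + 3 * α))) := by gcongr
        _ = 6 * (1 + K0) * (x ^ α * x ^ (-(2 + 3 * α))) := by ring
        _ = _ := by rw [p3]
    nlinarith

lemma cov_bound (hZ : ∀ t, Measurable (Z t)) (hs : Stationary μ Z) (f : (ℤ → ℝ) → ℝ)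
    (α C K : ℝ) (m : ℕ) (hm : 1 ≤ m) (hα : 0 < α)
    (hβ : betaMix μ Z m ≤ (m : ℝ) ^ (-(2 + 4 * α)))
    (hg : ∃ h, GoodApprox μ Z f α C K m h) (k : ℕ) (hk : 3 * m ≤ k) :
    |∫ z, f (shiftZ 0 z) * f (shiftZ k z) ∂(pathLaw μ Z)| ≤ (C + 4) * ((m : ℝ) ^ 2)⁻¹ := by
  obtain ⟨h, mh, dh, bh, e0, e1, e3, ec⟩ := hg
  have hx : (1 : ℝ) ≤ m := by exact_mod_cast hm
  have hx0 : (0 : ℝ) < m := by linarith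
  have c1 := cov_path μ Z hZ hs m (-(m : ℤ)) m (k - m) (by omega) (by omega)
    (fun z => h (shiftZ 0 z)) (fun z => h (shiftZ k z)) (mh.comp (measurable_shiftZ _))
    (mh.comp (measurable_shiftZ _)) (DependsOn.shiftZ dh _ fun i hi => by simpa using hi)
    (DependsOn.shiftZ dh _ fun i hi => by simp only [Set.mem_Icc, Set.mem_Ici] at hi ⊢; omega)
    (2 * (m : ℝ) ^ α) (2 * (m : ℝ) ^ α) (by positivity) (by positivity) (fun z => bh _)
    (fun z => bh _)
  have E := integral_shiftZ hZ hs 0 mh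
  simp only [E, e0, zero_mul, sub_zero] at c1
  have c2 := ec 0 k
  have c3 : 2 * (m : ℝ) ^ α * (2 * (m : ℝ) ^ α) * betaMix μ Z m ≤ 4 * (m : ℝ) ^ (-(2 + 2 * α)) := by
    calc _ ≤ 2 * (m : ℝ) ^ α * (2 * (m : ℝ) ^ α) * (m : ℝ) ^ (-(2 + 4 * α)) := by gcongr
      _ = 4 * ((m : ℝ) ^ α * (m : ℝ) ^ α * (m : ℝ) ^ (-(2 + 4 * α))) := by ring
      _ = _ := by
        rw [← Real.rpow_add hx0, ← Real.rpow_add hx0]; congr 2; ring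
  have c4 : (m : ℝ) ^ (-(2 + 2 * α)) ≤ ((m : ℝ) ^ 2)⁻¹ := by
    rw [← Real.rpow_natCast, ← Real.rpow_neg hx0.le]
    refine Real.rpow_le_rpow_of_exponent_le hx ?_
    push_cast; linarith
  have q2 : 0 < (m : ℝ) ^ (-(2 + 2 * α)) := by positivity
  have c5 : |∫ z, f (shiftZ 0 z) * f (shiftZ k z) ∂(pathLaw μ Z)|
      ≤ (C + 4) * (m : ℝ) ^ (-(2 + 2 * α)) := by
    have := abs_sub_abs_le_abs_sub (∫ z, f (shiftZ 0 z) * f (shiftZ k z) ∂(pathLaw μ Z))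
      (∫ z, h (shiftZ 0 z) * h (shiftZ k z) ∂(pathLaw μ Z))
    linarith
  have hC : 0 ≤ C + 4 := by
    by_contra hh
    push Not at hh
    have := abs_nonneg (∫ z, f (shiftZ 0 z) * f (shiftZ k z) ∂(pathLaw μ Z))
    nlinarith
  exact c5.trans (by gcongr)

lemma summable_cov (hZ : ∀ t, Measurable (Z t)) (hs : Stationary μ Z) (f : (ℤ → ℝ) → ℝ)
    (α C K : ℝ) (hα : 0 < α) (hC : 0 ≤ C) (hev : ∀ᶠ m : ℕ in atTop,
      betaMix μ Z m ≤ (m : ℝ) ^ (-(2 + 4 * α)) ∧ ∃ h, GoodApprox μ Z f α C K m h) :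
    Summable fun k : ℕ => ∫ z, f (shiftZ 0 z) * f (shiftZ ((k : ℤ) + 1) z) ∂(pathLaw μ Z) := by
  have s1 : Summable fun k : ℕ => (C + 4) * 36 * (((k + 1 : ℕ) : ℝ) ^ 2)⁻¹ :=
    (((summable_nat_add_iff 1).2 (Real.summable_nat_pow_inv.2 one_lt_two))).mul_left _
  refine Summable.of_norm_bounded_eventually_nat s1 ?_
  have ht : Tendsto (fun k : ℕ => (k + 1) / 3) atTop atTop :=
    (Nat.tendsto_div_const_atTop (by norm_num)).comp (tendsto_add_atTop_nat 1)
  filter_upwards [ht.eventually hev, eventually_ge_atTop 10] with k hk hk10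
  have hm : 1 ≤ (k + 1) / 3 := by omega
  have := cov_bound μ Z hZ hs f α C K _ hm hα hk.1 hk.2 (k + 1) (by omega)
  rw [Real.norm_eq_abs]
  push_cast at this ⊢
  refine this.trans ?_
  have h6 : ((k : ℝ) + 1) ≤ 6 * ((k + 1) / 3 : ℕ) := by
    have : k + 1 ≤ 6 * ((k + 1) / 3) := by omega
    exact_mod_cast this
  have hm0 : (0 : ℝ) < ((k + 1) / 3 : ℕ) := by exact_mod_cast hm
  rw [mul_assoc]
  gcongr
  rw [← div_eq_mul_inv, inv_le_comm₀ (by positivity) (by positivity), inv_div,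
    div_le_iff₀ (by norm_num)]
  nlinarith

lemma tendsto_vv (hZ : ∀ t, Measurable (Z t)) (hs : Stationary μ Z) (f : (ℤ → ℝ) → ℝ)
    (α C K : ℝ) (hα : 0 < α) (hC : 0 ≤ C) (hev : ∀ᶠ m : ℕ in atTop,
      betaMix μ Z m ≤ (m : ℝ) ^ (-(2 + 4 * α)) ∧ ∃ h, GoodApprox μ Z f α C K m h)
    (h : ℕ → (ℤ → ℝ) → ℝ) (hh : ∀ᶠ m : ℕ in atTop, GoodApprox μ Z f α C K m (h m)) :
    Tendsto (fun m : ℕ => vv μ Z (h m) (3 * m - 1)) atTop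
      (nhds ((∫ z, f (shiftZ 0 z) * f (shiftZ 0 z) ∂(pathLaw μ Z)) / 2 +
        ∑' k : ℕ, ∫ z, f (shiftZ 0 z) * f (shiftZ ((k : ℤ) + 1) z) ∂(pathLaw μ Z))) := by
  have hS := (summable_cov μ Z hZ hs f α C K hα hC hev).hasSum.tendsto_sum_nat
  have ht : Tendsto (fun m : ℕ => 3 * m - 1) atTop atTop :=
    tendsto_atTop_atTop.2 fun b => ⟨b + 1, fun a ha => by omega⟩
  have h1 : Tendsto (fun m : ℕ => vv μ Z f (3 * m - 1)) atTop
      (nhds ((∫ z, f (shiftZ 0 z) * f (shiftZ 0 z) ∂(pathLaw μ Z)) / 2 +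
        ∑' k : ℕ, ∫ z, f (shiftZ 0 z) * f (shiftZ ((k : ℤ) + 1) z) ∂(pathLaw μ Z))) :=
    (hS.comp ht).const_add _
  have h2 : Tendsto (fun m : ℕ => vv μ Z f (3 * m - 1) - vv μ Z (h m) (3 * m - 1)) atTop
      (nhds 0) := by
    have hz : Tendsto (fun m : ℕ => 3 * C * ((m : ℝ))⁻¹) atTop (nhds 0) := by
      simpa using (tendsto_inv_atTop_nhds_zero_nat (𝕜 := ℝ)).const_mul (3 * C)
    refine squeeze_zero_norm' ?_ hz
    filter_upwards [hh, eventually_ge_atTop 1] with m hg hm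
    obtain ⟨mh, dh, bh, e0, e1, e3, ec⟩ := hg
    have hx : (1 : ℝ) ≤ m := by exact_mod_cast hm
    have hx0 : (0 : ℝ) < m := by linarith
    have c4 : (m : ℝ) ^ (-(2 + 2 * α)) ≤ ((m : ℝ) ^ 2)⁻¹ := by
      rw [← Real.rpow_natCast, ← Real.rpow_neg hx0.le]
      refine Real.rpow_le_rpow_of_exponent_le hx ?_
      push_cast; linarith
    set q := C * (m : ℝ) ^ (-(2 + 2 * α)) with hq
    have hq0 : 0 ≤ q := by positivity
    have e : vv μ Z f (3 * m - 1) - vv μ Z (h m) (3 * m - 1)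
      = (∫ z, f (shiftZ 0 z) * f (shiftZ 0 z) ∂(pathLaw μ Z)
          - ∫ z, h m (shiftZ 0 z) * h m (shiftZ 0 z) ∂(pathLaw μ Z)) / 2
        + ∑ i ∈ Finset.range (3 * m - 1),
          (∫ z, f (shiftZ 0 z) * f (shiftZ ((i : ℤ) + 1) z) ∂(pathLaw μ Z)
          - ∫ z, h m (shiftZ 0 z) * h m (shiftZ ((i : ℤ) + 1) z) ∂(pathLaw μ Z)) := by
      unfold vv
      rw [Finset.sum_sub_distrib]
      ring
    rw [e, Real.norm_eq_abs]
    refine (abs_add_le _ _).trans ?_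
    have t1 := ec 0 0
    have t2 : |∑ i ∈ Finset.range (3 * m - 1),
          (∫ z, f (shiftZ 0 z) * f (shiftZ ((i : ℤ) + 1) z) ∂(pathLaw μ Z)
          - ∫ z, h m (shiftZ 0 z) * h m (shiftZ ((i : ℤ) + 1) z) ∂(pathLaw μ Z))|
        ≤ ((3 * m - 1 : ℕ) : ℝ) * q := by
      refine (Finset.abs_sum_le_sum_abs _ _).trans ?_
      refine (Finset.sum_le_card_nsmul _ _ q fun i _ => ec 0 _).trans ?_
      simp
    have t3 : (((3 * m - 1 : ℕ) : ℝ)) = 3 * m - 1 := by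
      rw [Nat.cast_sub (by omega)]; push_cast; ring
    rw [t3] at t2
    rw [abs_div, abs_two]
    have t4 : q * m ≤ C * (m : ℝ)⁻¹ := by
      calc q * m ≤ C * ((m : ℝ) ^ 2)⁻¹ * m := by rw [hq]; gcongr
        _ = _ := by field_simp
    nlinarith
  simpa using h1.sub h2
end

/-- the window length -/
def win (α : ℝ) (n : ℕ) : ℕ := ⌈(n : ℝ) ^ (1 / (4 * (1 + α)))⌉₊

lemma win_le (α : ℝ) (hα : 0 < α) (n : ℕ) (hn : 1 ≤ n) :
    (n : ℝ) ^ (1 / (4 * (1 + α))) ≤ win α n ∧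
      (win α n : ℝ) ≤ 2 * (n : ℝ) ^ (1 / (4 * (1 + α))) := by
  have hn' : (1 : ℝ) ≤ n := by exact_mod_cast hn
  have h1 : 1 ≤ (n : ℝ) ^ (1 / (4 * (1 + α))) := Real.one_le_rpow hn' (by positivity)
  refine ⟨Nat.le_ceil _, ?_⟩
  have := Nat.ceil_lt_add_one (a := (n : ℝ) ^ (1 / (4 * (1 + α)))) (by linarith)
  unfold win
  linarith

lemma tendsto_win (α : ℝ) (hα : 0 < α) : Tendsto (win α) atTop atTop := by
  have h1 : Tendsto (fun n : ℕ => (n : ℝ) ^ (1 / (4 * (1 + α)))) atTop atTop :=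
    (tendsto_rpow_atTop (by positivity)).comp tendsto_natCast_atTop_atTop
  exact tendsto_nat_ceil_atTop.comp h1

lemma tendsto_natCast_rpow_neg {e : ℝ} (he : e < 0) :
    Tendsto (fun n : ℕ => (n : ℝ) ^ e) atTop (nhds 0) := by
  have := (tendsto_rpow_neg_atTop (y := -e) (by linarith)).comp
    (tendsto_natCast_atTop_atTop (R := ℝ))
  simpa [Function.comp_def] using this

lemma tendsto_win_sq (α : ℝ) (hα : 0 < α) :
    Tendsto (fun n : ℕ => (win α n : ℝ) ^ 2 / Real.sqrt n) atTop (nhds 0) := by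
  have he : 2 * (1 / (4 * (1 + α))) - 1 / 2 < 0 := by
    have : 2 * (1 / (4 * (1 + α))) - 1 / 2 = -(α / (2 * (1 + α))) := by field_simp; ring
    rw [this, neg_lt_zero]; positivity
  have h1 := (tendsto_natCast_rpow_neg he).const_mul 4
  rw [mul_zero] at h1
  refine squeeze_zero' (Eventually.of_forall fun n => by positivity) ?_ h1
  filter_upwards [eventually_ge_atTop 1] with n hn
  have hn0 : (0 : ℝ) < n := by exact_mod_cast hn
  obtain ⟨_, h2⟩ := win_le α hα n hn
  rw [div_le_iff₀ (by positivity), Real.sqrt_eq_rpow, mul_assoc, ← Real.rpow_add hn0]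
  calc (win α n : ℝ) ^ 2 ≤ (2 * (n : ℝ) ^ (1 / (4 * (1 + α)))) ^ 2 := by gcongr
    _ = 4 * ((n : ℝ) ^ (1 / (4 * (1 + α))) * (n : ℝ) ^ (1 / (4 * (1 + α)))) := by ring
    _ = _ := by rw [← Real.rpow_add hn0]; congr 2; ring

lemma tendsto_win_rate (α : ℝ) (hα : 0 < α) :
    Tendsto (fun n : ℕ => Real.sqrt n * (win α n : ℝ) ^ (-(2 + 3 * α))) atTop (nhds 0) := by
  have he : 1 / 2 + (1 / (4 * (1 + α))) * (-(2 + 3 * α)) < 0 := by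
    have : 1 / 2 + (1 / (4 * (1 + α))) * (-(2 + 3 * α)) = -(α / (4 * (1 + α))) := by
      field_simp; ring
    rw [this, neg_lt_zero]; positivity
  refine squeeze_zero' (Eventually.of_forall fun n => by positivity) ?_
    (tendsto_natCast_rpow_neg he)
  filter_upwards [eventually_ge_atTop 1] with n hn
  have hn0 : (0 : ℝ) < n := by exact_mod_cast hn
  obtain ⟨h2, _⟩ := win_le α hα n hn
  rw [Real.rpow_add hn0, Real.rpow_mul hn0.le, Real.sqrt_eq_rpow]
  refine mul_le_mul_of_nonneg_left ?_ (by positivity)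
  exact Real.rpow_le_rpow_of_nonpos (by positivity) h2 (by linarith)

section
variable {Ω : Type*} [MeasurableSpace Ω] (μ : Measure Ω) [IsProbabilityMeasure μ]
  (Z : ℤ → Ω → ℝ)

lemma replace_l1 (hZ : ∀ t, Measurable (Z t)) (hs : Stationary μ Z) {f h : (ℤ → ℝ) → ℝ}
    (mf : Measurable f) (mh : Measurable h) (jf : Integrable f (pathLaw μ Z))
    (jh : Integrable h (pathLaw μ Z)) (c : ℝ) (n : ℕ) :
    ‖∫ z, ex (c * blk f 0 n z) ∂(pathLaw μ Z) - ∫ z, ex (c * blk h 0 n z) ∂(pathLaw μ Z)‖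
      ≤ |c| * (n * ∫ z, |f z - h z| ∂(pathLaw μ Z)) := by
  have := isProb_pathLaw μ Z hZ
  have jd : Integrable (fun z => |f z - h z|) (pathLaw μ Z) := (jf.sub jh).abs
  have js : ∀ t, Integrable (fun z => |f (shiftZ t z) - h (shiftZ t z)|) (pathLaw μ Z) := fun t =>
    integrable_shiftZ hZ hs t jd
  rw [← integral_sub (integrable_ex _ ((measurable_blk mf _ _).const_mul c))
    (integrable_ex _ ((measurable_blk mh _ _).const_mul c))]
  refine (norm_integral_le_of_norm_le (g := fun z => |c| * ∑ i ∈ Finset.range n,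
    |f (shiftZ (((0 : ℕ) : ℤ) + i + 1) z) - h (shiftZ (((0 : ℕ) : ℤ) + i + 1) z)|)
    ((integrable_finsetSum _ fun i _ => js _).const_mul _) (ae_of_all _ fun z => ?_)).trans ?_
  · refine (norm_ex_sub _ _).trans ?_
    rw [← mul_sub, abs_mul]
    gcongr
    unfold blk
    rw [← Finset.sum_sub_distrib]
    exact Finset.abs_sum_le_sum_abs _ _
  · rw [integral_const_mul, integral_finsetSum _ fun i _ => js _]
    have e : ∀ t, ∫ z, |f (shiftZ t z) - h (shiftZ t z)| ∂(pathLaw μ Z)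
        = ∫ z, |f z - h z| ∂(pathLaw μ Z) := fun t =>
      integral_shiftZ hZ hs t (F := fun z => |f z - h z|) (mf.sub mh).abs
    simp [e]

set_option maxHeartbeats 2000000 in
lemma clt_char (hZ : ∀ t, Measurable (Z t)) (hs : Stationary μ Z) (f : (ℤ → ℝ) → ℝ)
    (mf : Measurable f) (jf : Integrable f (pathLaw μ Z))
    (α C K : ℝ) (hα : 0 < α) (hC : 0 ≤ C) (hev : ∀ᶠ m : ℕ in atTop,
      betaMix μ Z m ≤ (m : ℝ) ^ (-(2 + 4 * α)) ∧ ∃ h, GoodApprox μ Z f α C K m h)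
    (V : ℝ) (hV : V = (∫ z, f (shiftZ 0 z) * f (shiftZ 0 z) ∂(pathLaw μ Z)) / 2 +
        ∑' k : ℕ, ∫ z, f (shiftZ 0 z) * f (shiftZ ((k : ℤ) + 1) z) ∂(pathLaw μ Z)) (s : ℝ) :
    Tendsto (fun n : ℕ => ∫ z, ex (s / Real.sqrt n * blk f 0 n z) ∂(pathLaw μ Z)) atTop
      (nhds (Complex.exp ((-(s ^ 2 * V) : ℝ) : ℂ))) := by
  classical
  have := isProb_pathLaw μ Z hZ
  -- choose the family
  set h : ℕ → (ℤ → ℝ) → ℝ := fun m =>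
    if hm : ∃ h, GoodApprox μ Z f α C K m h then hm.choose else 0 with hh
  have hgood : ∀ᶠ m : ℕ in atTop, GoodApprox μ Z f α C K m (h m) := by
    filter_upwards [hev] with m hm
    simp only [hh, dif_pos hm.2]
    exact hm.2.choose_spec
  have hvm := tendsto_vv μ Z hZ hs f α C K hα hC hev h hgood
  rw [← hV] at hvm
  have hwin := tendsto_win α hα
  set v : ℕ → ℝ := fun n => vv μ Z (h (win α n)) (3 * win α n - 1) with hv
  have tv : Tendsto v atTop (nhds V) := hvm.comp hwin
  set q : ℕ → ℝ := fun n => (win α n : ℝ) ^ 2 / Real.sqrt n with hq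
  set r : ℕ → ℝ := fun n => Real.sqrt n * (win α n : ℝ) ^ (-(2 + 3 * α)) with hr
  have tq : Tendsto q atTop (nhds 0) := tendsto_win_sq α hα
  have tr : Tendsto r atTop (nhds 0) := tendsto_win_rate α hα
  have ti : Tendsto (fun n => ((win α n : ℕ) : ℝ)⁻¹) atTop (nhds 0) :=
    (tendsto_inv_atTop_nhds_zero_nat (𝕜 := ℝ)).comp hwin
  have evn : ∀ᶠ n : ℕ in atTop, (n : ℝ) * (s / Real.sqrt n) ^ 2 = s ^ 2 := by
    filter_upwards [eventually_ge_atTop 1] with n hn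
    have hn0 : (0 : ℝ) < n := by exact_mod_cast hn
    rw [div_pow, Real.sq_sqrt hn0.le]
    field_simp
  -- main term
  have main : Tendsto (fun n : ℕ => ((1 - (s / Real.sqrt n) ^ 2 * v n : ℝ) : ℂ) ^ n) atTop
      (nhds (Complex.exp ((-(s ^ 2 * V) : ℝ) : ℂ))) := by
    have t1 : Tendsto (fun n : ℕ => (1 + -((s / Real.sqrt n) ^ 2 * v n)) ^ n) atTop
        (nhds (Real.exp (-(s ^ 2 * V)))) := by
      refine Real.tendsto_one_add_pow_exp_of_tendsto ?_
      refine ((tv.const_mul (s ^ 2)).neg).congr' ?_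
      filter_upwards [evn] with n hn
      linear_combination (v n) * hn
    have t2 := (Complex.continuous_ofReal.tendsto _).comp t1
    rw [Complex.ofReal_exp] at t2
    refine t2.congr fun n => ?_
    simp only [Function.comp]
    rw [Complex.ofReal_pow, sub_eq_add_neg]
  have tG : Tendsto (fun n : ℕ => (1 + (s / Real.sqrt n) ^ 2 * |v n|) ^ n) atTop
      (nhds (Real.exp (s ^ 2 * |V|))) := by
    refine Real.tendsto_one_add_pow_exp_of_tendsto ?_
    refine ((tv.abs.const_mul (s ^ 2))).congr' ?_
    filter_upwards [evn] with n hn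
    linear_combination (-|v n|) * hn
  have tE : Tendsto (fun n : ℕ => (1 + (s / Real.sqrt n) ^ 2 * |v n|) ^ n *
      (288 * |s| ^ 3 * K * q n + 4 * |s| * r n + 24 * s ^ 2 * ((win α n : ℕ) : ℝ)⁻¹
        + 6 * |s| ^ 3 * K * (q n * |v n|) + (6 * |s| * K * q n + 6 * s ^ 2 * (q n * |v n|)))
      + |s| * C * r n) atTop (nhds 0) := by
    have t3 : Tendsto (fun n => q n * |v n|) atTop (nhds 0) := by
      simpa using tq.mul tv.abs
    have := (tG.mul ((((tq.const_mul (288 * |s| ^ 3 * K)).add (tr.const_mul (4 * |s|))).add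
      (ti.const_mul (24 * s ^ 2))).add (t3.const_mul (6 * |s| ^ 3 * K)) |>.add
      ((tq.const_mul (6 * |s| * K)).add (t3.const_mul (6 * s ^ 2))))).add
      (tr.const_mul (|s| * C))
    simpa using this
  have tdiff : Tendsto (fun n : ℕ => ∫ z, ex (s / Real.sqrt n * blk f 0 n z) ∂(pathLaw μ Z)
      - ((1 - (s / Real.sqrt n) ^ 2 * v n : ℝ) : ℂ) ^ n) atTop (nhds 0) := by
    refine squeeze_zero_norm' ?_ tE
    filter_upwards [hwin.eventually hgood, hwin.eventually hev, eventually_ge_atTop 1,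
      hwin.eventually_ge_atTop 1] with n hg hb hn hm
    obtain ⟨mh, dh, bh, e0, e1, e3, -⟩ := hg
    have hb := hb.1
    set m := win α n with hmdef
    set c := s / Real.sqrt n with hc
    have hn0 : (1 : ℝ) ≤ n := by exact_mod_cast hn
    have hx : (1 : ℝ) ≤ m := by exact_mod_cast hm
    have hx0 : (0 : ℝ) < m := by linarith
    have hS : 0 < Real.sqrt n := Real.sqrt_pos.2 (by linarith)
    have hS1 : 1 ≤ Real.sqrt n := Real.one_le_sqrt.2 hn0
    have hSS : Real.sqrt n * Real.sqrt n = n := Real.mul_self_sqrt (by linarith)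
    set S := Real.sqrt n with hSdef
    have jh : Integrable (h m) (pathLaw μ Z) :=
      Integrable.of_bound mh.aestronglyMeasurable _ (ae_of_all _ fun z => bh z)
    have hK0 : 0 ≤ K := (integral_nonneg fun z => by positivity).trans e3
    have b1 := replace_l1 μ Z hZ hs mf mh jf jh c n
    have b2 := chain_mix μ Z hZ hs mh m (3 * m - 1) hm (by omega) dh ((m : ℝ) ^ α) (by positivity)
      bh e0 K e3 c n
    have hcn : |c| = |s| / S := by rw [hc, abs_div, abs_of_pos hS]
    have hcn2 : c ^ 2 = s ^ 2 / n := by rw [hc, div_pow, sq S, hSS]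
    have hnS : (n : ℝ) / S = S := by rw [← hSS]; field_simp
    have hm1 : (m : ℝ) / S ≤ q n := by
      change (m : ℝ) / S ≤ (m : ℝ) ^ 2 / S
      gcongr; nlinarith
    have hvv : vv μ Z (h m) (3 * m - 1) = v n := rfl
    rw [hvv] at b2
    have hβ0 := betaMix_nonneg μ Z m
    have g1 : (n : ℝ) * (4 * |c| ^ 3 * (72 * m ^ 2 * K)) = 288 * |s| ^ 3 * K * q n := by
      have : (n : ℝ) * |c| ^ 3 = |s| ^ 3 / S := by
        rw [hcn, div_pow, ← hSS]; field_simp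
      calc (n : ℝ) * (4 * |c| ^ 3 * (72 * m ^ 2 * K)) = 288 * (n * |c| ^ 3) * m ^ 2 * K := by ring
        _ = _ := by rw [this, hq]; ring
    have g2 : (n : ℝ) * (|c| * (2 * (2 * (m : ℝ) ^ α) * betaMix μ Z m)) ≤ 4 * |s| * r n := by
      have : (n : ℝ) * |c| = |s| * S := by rw [hcn, ← hSS]; field_simp
      calc (n : ℝ) * (|c| * (2 * (2 * (m : ℝ) ^ α) * betaMix μ Z m))
          = 4 * (n * |c|) * ((m : ℝ) ^ α * betaMix μ Z m) := by ring
        _ ≤ 4 * (n * |c|) * ((m : ℝ) ^ α * (m : ℝ) ^ (-(2 + 4 * α))) := by gcongr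
        _ = 4 * (|s| * S) * (m : ℝ) ^ (-(2 + 3 * α)) := by
          rw [this, ← Real.rpow_add hx0]; congr 2; ring
        _ = _ := by rw [hr]; ring
    have g3 : (n : ℝ) * (c ^ 2 * (2 * (12 * m * ((m : ℝ) ^ α) ^ 2) * betaMix μ Z m))
        ≤ 24 * s ^ 2 * (m : ℝ)⁻¹ := by
      have e1 : (n : ℝ) * c ^ 2 = s ^ 2 := by rw [hcn2]; field_simp
      have e2 : (m : ℝ) * ((m : ℝ) ^ α) ^ 2 * betaMix μ Z m ≤ (m : ℝ)⁻¹ := by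
        calc _ ≤ (m : ℝ) * ((m : ℝ) ^ α) ^ 2 * (m : ℝ) ^ (-(2 + 4 * α)) := by gcongr
          _ = (m : ℝ) ^ (1 + 2 * α + (-(2 + 4 * α))) := by
            rw [Real.rpow_add hx0, Real.rpow_add hx0, Real.rpow_one, mul_comm 2 α,
              Real.rpow_mul hx0.le]
            norm_num
          _ ≤ (m : ℝ) ^ (-1 : ℝ) := Real.rpow_le_rpow_of_exponent_le hx (by linarith)
          _ = _ := Real.rpow_neg_one _
      calc _ = 24 * (n * c ^ 2) * ((m : ℝ) * ((m : ℝ) ^ α) ^ 2 * betaMix μ Z m) := by ring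
        _ ≤ 24 * (n * c ^ 2) * (m : ℝ)⁻¹ := by gcongr
        _ = _ := by rw [e1]
    have g4 : (n : ℝ) * (|c| ^ 3 * (6 * m * K) * |v n|) ≤ 6 * |s| ^ 3 * K * (q n * |v n|) := by
      have : (n : ℝ) * |c| ^ 3 = |s| ^ 3 / S := by
        rw [hcn, div_pow, ← hSS]; field_simp
      calc _ = 6 * (n * |c| ^ 3) * m * K * |v n| := by ring
        _ = 6 * |s| ^ 3 * K * ((m / S) * |v n|) := by rw [this]; ring
        _ ≤ _ := by gcongr
    have g5 : ((6 * m : ℕ) : ℝ) * (|c| * K + c ^ 2 * |v n|)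
        ≤ 6 * |s| * K * q n + 6 * s ^ 2 * (q n * |v n|) := by
      have k1 : (m : ℝ) * |c| ≤ |s| * q n := by
        rw [hcn]
        calc _ = |s| * (m / S) := by ring
          _ ≤ _ := by gcongr
      have k2 : (m : ℝ) * c ^ 2 ≤ s ^ 2 * q n := by
        rw [hcn2]
        have : (m : ℝ) / n ≤ m / S := by
          gcongr; nlinarith
        calc _ = s ^ 2 * (m / n) := by ring
          _ ≤ s ^ 2 * (m / S) := by gcongr
          _ ≤ _ := by gcongr
      push_cast
      calc _ = 6 * (m * |c|) * K + 6 * (m * c ^ 2) * |v n| := by ring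
        _ ≤ 6 * (|s| * q n) * K + 6 * (s ^ 2 * q n) * |v n| := by gcongr
        _ = _ := by ring
    have g6 : |c| * (n * ∫ z, |f z - h m z| ∂(pathLaw μ Z)) ≤ |s| * C * r n := by
      have : (n : ℝ) * |c| = |s| * S := by rw [hcn, ← hSS]; field_simp
      calc _ = (n * |c|) * ∫ z, |f z - h m z| ∂(pathLaw μ Z) := by ring
        _ ≤ (n * |c|) * (C * (m : ℝ) ^ (-(2 + 3 * α))) := by gcongr
        _ = _ := by rw [this, hr]; ring
    have tri := norm_sub_le_norm_sub_add_norm_sub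
      (∫ z, ex (c * blk f 0 n z) ∂(pathLaw μ Z))
      (∫ z, ex (c * blk (h m) 0 n z) ∂(pathLaw μ Z))
      (((1 - c ^ 2 * v n : ℝ) : ℂ) ^ n)
    refine tri.trans ?_
    rw [add_comm]
    refine add_le_add (b2.trans ?_) (b1.trans g6)
    have hGn : 0 ≤ (1 + c ^ 2 * |v n|) ^ n := by positivity
    refine mul_le_mul_of_nonneg_left ?_ hGn
    rw [mul_add, mul_add, mul_add]
    linarith
  simpa using tdiff.add main
end

/-- CLT for partial sums of 1-approximating functionals: Under zero mean,
`E|X_0|^{4+δ} < ∞` and `Σ_{k≥d} k²(a_k^{δ/(3+δ)} + β_k^{δ/(4+δ)}) < ∞`,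
`n^{-1/2} Σ_{t=1}^n X_t →d N(0, σ²)` with `σ² = E X_0² + 2 Σ_{k≥1} E(X_0 X_k)`
(point mass at the origin if `σ² = 0`). -/
theorem stmt_15 {Ω : Type*} [MeasurableSpace Ω] (μ : Measure Ω) [IsProbabilityMeasure μ]
    (Z : ℤ → Ω → ℝ) (hZmeas : ∀ t, Measurable (Z t)) (hstat : Stationary μ Z)
    (β : ℕ → ℝ) (hβ : ∀ k, β k = betaMix μ Z k) (hreg : Tendsto β atTop (nhds 0))
    (f : (ℤ → ℝ) → ℝ) (hf : Measurable f)
    (X : ℤ → Ω → ℝ) (hX : ∀ t ω, X t ω = f (fun k => Z (t + k) ω))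
    (a : ℕ → ℝ) (ha0 : Tendsto a atTop (nhds 0)) (hann : ∀ k, 0 ≤ a k)
    (happrox : ∀ k : ℕ,
      ∫ ω, |X 0 ω - (μ[X 0 | sigmaIcc Z (-(k : ℤ)) (k : ℤ)]) ω| ∂μ ≤ a k)
    (hXint : Integrable (X 0) μ) (hmean : ∫ ω, X 0 ω ∂μ = 0)
    (d : ℕ) (δ : ℝ) (hδ : 0 < δ)
    (hmom : Integrable (fun ω => |X 0 ω| ^ ((4 : ℝ) + δ)) μ)
    (hsum : Summable (fun k : ℕ => ((d + k : ℕ) : ℝ) ^ 2 *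
      (a (d + k) ^ (δ / (3 + δ)) + β (d + k) ^ (δ / (4 + δ)))))
    (σ2 : ℝ)
    (hσ2 : σ2 = ∫ ω, (X 0 ω) ^ 2 ∂μ
      + 2 * ∑' k : ℕ, ∫ ω, X 0 ω * X ((k : ℤ) + 1) ω ∂μ) :
    ∀ g : BoundedContinuousFunction ℝ ℝ,
      Tendsto (fun n : ℕ =>
          ∫ ω, g ((1 / Real.sqrt n) * ∑ t ∈ Finset.Icc 1 n, X (t : ℤ) ω) ∂μ) atTop
        (nhds (∫ x, g x ∂(gaussianReal 0 (Real.toNNReal σ2)))) := by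
  have hprob := isProb_pathLaw μ Z hZmeas
  have mpath : Measurable fun ω => fun s : ℤ => Z s ω := measurable_path hZmeas
  have hXs : ∀ t ω, X t ω = f (shiftZ t (fun s => Z s ω)) := fun t ω => hX t ω
  have hX0 : ∀ ω, X 0 ω = f (fun s => Z s ω) := by
    intro ω; rw [hX]; simp
  have mX : ∀ t, Measurable (X t) := fun t => by
    have : X t = fun ω => f (shiftZ t (fun s => Z s ω)) := funext (hXs t)
    rw [this]
    exact hf.comp ((measurable_shiftZ t).comp mpath)
  have toInt : ∀ {F : (ℤ → ℝ) → ℝ}, Measurable F →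
      Integrable (fun ω => F (fun s => Z s ω)) μ → Integrable F (pathLaw μ Z) := by
    intro F mF hF
    exact (integrable_map_measure mF.aestronglyMeasurable mpath.aemeasurable).2 hF
  have jf : Integrable f (pathLaw μ Z) := toInt hf (by
    rwa [← (funext hX0 : X 0 = fun ω => f (fun s => Z s ω))])
  have jm : Integrable (fun z => |f z| ^ ((4 : ℝ) + δ)) (pathLaw μ Z) :=
    toInt (hf.abs.pow_const _) (by simpa only [hX0] using hmom)
  have em : ∫ z, f z ∂(pathLaw μ Z) = 0 := by
    rw [integral_pathLaw hZmeas hf]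
    simpa only [hX0] using hmean
  set K0 := ∫ z, |f z| ^ ((4 : ℝ) + δ) ∂(pathLaw μ Z) with hK0
  have hK0n : 0 ≤ K0 := integral_nonneg fun z => by positivity
  have hβn : ∀ k, 0 ≤ β k := fun k => by rw [hβ]; exact betaMix_nonneg μ Z k
  have hev : ∀ᶠ m : ℕ in atTop, betaMix μ Z m ≤ (m : ℝ) ^ (-(2 + 4 * (2 / δ))) ∧
      ∃ h, GoodApprox μ Z f (2 / δ) (10 * (1 + K0)) (1 + 76 * (1 + K0)) m h := by
    filter_upwards [ev_bound a β hann hβn d δ hδ hsum, eventually_ge_atTop 1] with m hm hm1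
    refine ⟨by rw [← hβ]; exact hm.2, ?_⟩
    exact exists_good μ Z hZmeas hstat f hf jf em δ hδ jm K0 le_rfl m hm1 (a m) hm.1
      (exists_window μ Z hZmeas f hf (X 0) hX0 _ _ (a m) (happrox m))
  have mff : ∀ i j, Measurable fun z => f (shiftZ i z) * f (shiftZ j z) := fun i j =>
    (hf.comp (measurable_shiftZ _)).mul (hf.comp (measurable_shiftZ _))
  have hV : σ2 / 2 = (∫ z, f (shiftZ 0 z) * f (shiftZ 0 z) ∂(pathLaw μ Z)) / 2 +
        ∑' k : ℕ, ∫ z, f (shiftZ 0 z) * f (shiftZ ((k : ℤ) + 1) z) ∂(pathLaw μ Z) := by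
    have e1 : ∫ z, f (shiftZ 0 z) * f (shiftZ 0 z) ∂(pathLaw μ Z) = ∫ ω, (X 0 ω) ^ 2 ∂μ := by
      rw [integral_pathLaw hZmeas (mff 0 0)]
      simp only [hXs, sq]
    have e2 : ∀ k : ℕ, ∫ z, f (shiftZ 0 z) * f (shiftZ ((k : ℤ) + 1) z) ∂(pathLaw μ Z)
        = ∫ ω, X 0 ω * X ((k : ℤ) + 1) ω ∂μ := by
      intro k
      rw [integral_pathLaw hZmeas (mff 0 _)]
      simp only [hXs]
    simp only [e1, e2]
    rw [hσ2]; ring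
  have hchar := clt_char μ Z hZmeas hstat f hf jf (2 / δ) (10 * (1 + K0)) (1 + 76 * (1 + K0))
    (by positivity) (by positivity) hev (σ2 / 2) hV
  -- nonnegativity of the long run variance
  have hσ0 : 0 ≤ σ2 := by
    have h1 := (hchar 1).norm
    have h2 : ‖Complex.exp ((-(1 ^ 2 * (σ2 / 2)) : ℝ) : ℂ)‖ ≤ 1 := by
      refine le_of_tendsto h1 (Eventually.of_forall fun n => ?_)
      have := norm_integral_le_of_norm_le_const (μ := pathLaw μ Z)
        (f := fun z => ex (1 / Real.sqrt n * blk f 0 n z)) (C := 1)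
        (ae_of_all _ fun z => (norm_ex _).le)
      simpa using this
    rw [← Complex.ofReal_exp, Complex.norm_real, Real.norm_eq_abs, Real.abs_exp,
      Real.exp_le_one_iff] at h2
    linarith
  set S : ℕ → Ω → ℝ := fun n ω => (1 / Real.sqrt n) * ∑ t ∈ Finset.Icc 1 n, X (t : ℤ) ω with hS
  have mS : ∀ n, Measurable (S n) := fun n =>
    (Finset.measurable_sum _ fun t _ => mX _).const_mul _
  have hSb : ∀ n ω, S n ω = 1 / Real.sqrt n * blk f 0 n (fun s => Z s ω) := by
    intro n ω
    simp only [hS]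
    congr 1
    unfold blk
    have hsr : ∀ (F : ℕ → ℝ) (n : ℕ), ∑ t ∈ Finset.Icc 1 n, F t
        = ∑ i ∈ Finset.range n, F (i + 1) := by
      intro F n
      induction n with
      | zero => simp
      | succ n ih => rw [Finset.sum_Icc_succ_top (by omega), ih, Finset.sum_range_succ]
    rw [hsr (fun t : ℕ => X (t : ℤ) ω)]
    refine Finset.sum_congr rfl fun i _ => ?_
    rw [hXs]
    push_cast
    rw [zero_add]
  set P : ℕ → ProbabilityMeasure ℝ := fun n =>
    ⟨μ.map (S n), Measure.isProbabilityMeasure_map (mS n).aemeasurable⟩ with hP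
  set P0 : ProbabilityMeasure ℝ := ⟨gaussianReal 0 (Real.toNNReal σ2), inferInstance⟩ with hP0
  have key : Tendsto P atTop (nhds P0) := by
    refine ProbabilityMeasure.tendsto_iff_tendsto_charFun.2 fun s => ?_
    have e0 : charFun (P0 : Measure ℝ) s = Complex.exp ((-(s ^ 2 * (σ2 / 2)) : ℝ) : ℂ) := by
      change charFun (gaussianReal 0 (Real.toNNReal σ2)) s = _
      rw [charFun_gaussianReal, Real.coe_toNNReal _ hσ0]
      congr 1
      push_cast
      ring
    rw [e0]
    refine (hchar s).congr fun n => ?_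
    change _ = charFun (μ.map (S n)) s
    have mex : Measurable fun z => ex (s / Real.sqrt n * blk f 0 n z) :=
      measurable_ex.comp ((measurable_blk hf _ _).const_mul _)
    rw [charFun_apply_real, integral_map (mS n).aemeasurable (by fun_prop),
      integral_pathLaw hZmeas mex]
    congr 1
    ext ω
    rw [hSb]
    unfold ex
    congr 1
    push_cast
    ring
  intro g
  have := ProbabilityMeasure.tendsto_iff_forall_integral_tendsto.1 key g
  refine this.congr fun n => ?_
  change ∫ x, g x ∂(μ.map (S n)) = _
  rw [integral_map (mS n).aemeasurable g.continuous.aestronglyMeasurable]
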